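/- arXiv:2506.20421 — 4 statements merged into one kernel-verified Lean document; each statement's English description precedes it below -/
import Mathlib

section
/- Let u, u', v, v' be four distinct points in the plane in general position (no three collinear) such that v and v' lie on strictly opposite sides of the straight line through u and u'. Then the quadrilateral with cyclic vertex sequence u, v, u', v' is non-self-crossing: the segment [u,v] is disjoint from the segment [u',v'], and the segment [v,u'] is disjoint from the segment [v',u]; consequently any two of the four segments [u,v], [v,u'], [u',v'], [v',u] intersect only if they share an endpoint, and then exactly in that common endpoint. -/
noncomputable section

/-- Points of the plane. -/
abbrev Pt : Type := ℝ × ℝ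

/-- Signed side of point `p` with respect to the oriented line through `u` and `u'`
(the usual cross-product / determinant test). -/
def sideSign (u u' p : Pt) : ℝ :=
  (u'.1 - u.1) * (p.2 - u.2) - (u'.2 - u.2) * (p.1 - u.1)

/-- `v` and `v'` lie on strictly opposite sides of the straight line through `u` and `u'`. -/
def StrictlyOppositeSides (u u' v v' : Pt) : Prop :=
  sideSign u u' v * sideSign u u' v' < 0

/-- A set of points is in general position: no three (distinct) points of it are collinear. -/
def GenPos (P : Set Pt) : Prop :=
  ∀ a ∈ P, ∀ b ∈ P, ∀ c ∈ P, a ≠ b → a ≠ c → b ≠ c →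
    ¬ Collinear ℝ ({a, b, c} : Set Pt)

/-- `γ : ZMod t → Pt` is a plane cycle of length `t` for the coloring `φ`:
a cyclic sequence of `t ≥ 3` distinct points in which cyclically consecutive points have
different colors, and in which two distinct edges meet exactly in their common endpoint
if they are cyclically consecutive, and not at all otherwise. -/
def IsPlaneCycle (φ : Pt → ℕ) (t : ℕ) (γ : ZMod t → Pt) : Prop :=
  3 ≤ t ∧ Function.Injective γ ∧
  (∀ i : ZMod t, φ (γ i) ≠ φ (γ (i + 1))) ∧
  ∀ i j : ZMod t, i ≠ j →
    (j = i + 1 →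
      segment ℝ (γ i) (γ (i + 1)) ∩ segment ℝ (γ j) (γ (j + 1)) = ({γ (i + 1)} : Set Pt)) ∧
    (j ≠ i + 1 → i ≠ j + 1 →
      segment ℝ (γ i) (γ (i + 1)) ∩ segment ℝ (γ j) (γ (j + 1)) = (∅ : Set Pt))

/-- A cycle is non-rainbow if some color appears on two of its points. -/
def NonRainbow (φ : Pt → ℕ) (t : ℕ) (γ : ZMod t → Pt) : Prop :=
  ∃ i j : ZMod t, i ≠ j ∧ φ (γ i) = φ (γ j)

/-- A set of points is in convex position (each point is a vertex of the convex hull). -/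
def ConvexPosition (s : Set Pt) : Prop :=
  ∀ p ∈ s, p ∉ convexHull ℝ (s \ {p})

theorem aux_side (u u' v v' p q : Pt) (hp : sideSign u u' p = 0) (hq : sideSign u u' q = 0)
    (hopp : StrictlyOppositeSides u u' v v') (x : Pt)
    (hx : x ∈ segment ℝ p v) (hy : x ∈ segment ℝ q v') : x = p ∧ x = q := by
  obtain ⟨a, b, ha, hb, hab, rfl⟩ := hx
  obtain ⟨c, d, hc, hd, hcd, he⟩ := hy
  unfold StrictlyOppositeSides at hopp
  have e1 : sideSign u u' (a • p + b • v) = b * sideSign u u' v := by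
    have : sideSign u u' (a • p + b • v) = a * sideSign u u' p + b * sideSign u u' v := by
      obtain rfl : a = 1 - b := by linarith
      simp [sideSign]; ring
    rw [this, hp]; ring
  have e2 : sideSign u u' (c • q + d • v') = d * sideSign u u' v' := by
    have : sideSign u u' (c • q + d • v') = c * sideSign u u' q + d * sideSign u u' v' := by
      obtain rfl : c = 1 - d := by linarith
      simp [sideSign]; ring
    rw [this, hq]; ring
  have e3 : b * sideSign u u' v = d * sideSign u u' v' := by rw [← e1, ← e2, he]
  generalize sideSign u u' v = S at *
  generalize sideSign u u' v' = T at *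
  have hS : S ≠ 0 := by rintro rfl; simp at hopp
  have hT : T ≠ 0 := by rintro rfl; simp at hopp
  have hz : b * S = 0 := by
    have k1 : (b * S) * (b * S) = (b * d) * (S * T) := by
      nth_rewrite 2 [e3]; ring
    have k2 : (b * d) * (S * T) ≤ 0 :=
      mul_nonpos_of_nonneg_of_nonpos (mul_nonneg hb hd) hopp.le
    have k3 := mul_self_nonneg (b * S)
    exact mul_self_eq_zero.1 (by linarith)
  have hb0 : b = 0 := by simpa [hS] using hz
  have hd0 : d = 0 := by rw [hz] at e3; simpa [hT] using e3.symm
  have ha1 : a = 1 := by linarith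
  have hc1 : c = 1 := by linarith
  refine ⟨by simp [hb0, ha1], ?_⟩
  rw [← he]; simp [hd0, hc1]

theorem aux_apex (u u' v : Pt) (h1 : u ≠ u') (hv : sideSign u u' v ≠ 0) :
    segment ℝ u v ∩ segment ℝ v u' = ({v} : Set Pt) := by
  apply Set.Subset.antisymm
  · rintro x ⟨⟨a, b, ha, hb, hab, rfl⟩, ⟨c, d, hc, hd, hcd, he⟩⟩
    obtain rfl : b = 1 - a := by linarith
    obtain rfl : c = 1 - d := by linarith
    have e1 : sideSign u u' (a • u + (1 - a) • v) = (1 - a) * sideSign u u' v := by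
      simp [sideSign]; ring
    have e2 : sideSign u u' ((1 - d) • v + d • u') = (1 - d) * sideSign u u' v := by
      simp [sideSign]; ring
    rw [he, e1] at e2
    have hda : 1 - a = 1 - d := mul_right_cancel₀ hv e2
    obtain rfl : a = d := by linarith
    have h : a • u' = a • u := by
      rw [add_comm] at he; exact add_right_cancel he
    by_cases h0 : a = 0
    · simp [h0]
    · exact absurd (smul_right_injective Pt h0 h).symm h1
  · rintro x rfl
    exact ⟨right_mem_segment ℝ _ _, left_mem_segment ℝ _ _⟩

/-- if `v` and `v'` lie on strictly opposite sides of the line through `u` and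
`u'`, then the quadrilateral `u, v, u', v'` is non-self-crossing. -/
theorem stmt_0 (u u' v v' : Pt)
    (h1 : u ≠ u') (h2 : u ≠ v) (h3 : u ≠ v') (h4 : u' ≠ v) (h5 : u' ≠ v') (h6 : v ≠ v')
    (hgp : GenPos ({u, u', v, v'} : Set Pt))
    (hopp : StrictlyOppositeSides u u' v v') :
    segment ℝ u v ∩ segment ℝ u' v' = (∅ : Set Pt) ∧
    segment ℝ v u' ∩ segment ℝ v' u = (∅ : Set Pt) ∧
    segment ℝ u v ∩ segment ℝ v u' = ({v} : Set Pt) ∧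
    segment ℝ v u' ∩ segment ℝ u' v' = ({u'} : Set Pt) ∧
    segment ℝ u' v' ∩ segment ℝ v' u = ({v'} : Set Pt) ∧
    segment ℝ v' u ∩ segment ℝ u v = ({u} : Set Pt) := by
  have hu : sideSign u u' u = 0 := by simp [sideSign]
  have hu' : sideSign u u' u' = 0 := by simp [sideSign]; ring
  have hv : sideSign u u' v ≠ 0 := by
    intro h; simp [StrictlyOppositeSides, h] at hopp
  have hv' : sideSign u u' v' ≠ 0 := by
    intro h; simp [StrictlyOppositeSides, h] at hopp
  refine ⟨?_, ?_, aux_apex u u' v h1 hv, ?_, ?_, ?_⟩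
  · rw [Set.eq_empty_iff_forall_notMem]
    rintro x ⟨hx, hy⟩
    obtain ⟨e, f⟩ := aux_side u u' v v' u u' hu hu' hopp x hx hy
    exact h1 (e.symm.trans f)
  · rw [Set.eq_empty_iff_forall_notMem, segment_symm ℝ v u', segment_symm ℝ v' u]
    rintro x ⟨hx, hy⟩
    obtain ⟨e, f⟩ := aux_side u u' v v' u' u hu' hu hopp x hx hy
    exact h1 (f.symm.trans e)
  · apply Set.Subset.antisymm
    · rw [segment_symm ℝ v u']
      rintro x ⟨hx, hy⟩
      exact (aux_side u u' v v' u' u' hu' hu' hopp x hx hy).1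
    · rintro x rfl
      exact ⟨right_mem_segment ℝ _ _, left_mem_segment ℝ _ _⟩
  · rw [Set.inter_comm, segment_symm ℝ v' u, segment_symm ℝ u' v']
    exact aux_apex u u' v' h1 hv'
  · apply Set.Subset.antisymm
    · rw [segment_symm ℝ v' u]
      rintro x ⟨hy, hx⟩
      exact (aux_side u u' v v' u u hu hu hopp x hx hy).1
    · rintro x rfl
      exact ⟨right_mem_segment ℝ _ _, left_mem_segment ℝ _ _⟩
end
end

section
/- Let u, u', v, v', w be five distinct points in the plane in general position such that u, u', v, v' are the vertices of a convex quadrilateral and w lies in the interior of that quadrilateral, and let φ be a coloring of these five points with four pairwise distinct colors φ1, φ2, φ3, φ4 such that φ(u)=φ(u')=φ1, φ(v)=φ2, φ(v')=φ3, φ(w)=φ4. Then there exists a plane cycle of length 5 through all five points in which any two cyclically consecutive points have different colors; this cycle is non-rainbow since the color φ1 appears on two of its points. -/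
noncomputable section

lemma sideSign_convex (p q r s : Pt) (x y : ℝ) (h : x + y = 1) :
    sideSign p q (x • r + y • s) = x * sideSign p q r + y * sideSign p q s := by
  obtain rfl : y = 1 - x := by linarith
  simp only [sideSign, Prod.fst_add, Prod.snd_add, Prod.smul_fst, Prod.smul_snd, smul_eq_mul]
  ring

lemma seg_disj (p q r s : Pt) (hr : 0 < sideSign p q r) (hs : 0 < sideSign p q s) :
    segment ℝ p q ∩ segment ℝ r s = ∅ := by
  ext z
  simp only [Set.mem_inter_iff, Set.mem_empty_iff_false, iff_false, not_and]
  rintro ⟨x, y, hx, hy, hxy, rfl⟩ ⟨x', y', hx', hy', hxy', h⟩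
  have h1 := congrArg (sideSign p q) h
  rw [sideSign_convex _ _ _ _ _ _ hxy, sideSign_convex _ _ _ _ _ _ hxy'] at h1
  have h2 : sideSign p q p = 0 := by simp [sideSign]
  have h3 : sideSign p q q = 0 := by simp only [sideSign]; ring
  rw [h2, h3] at h1
  rcases hx'.lt_or_eq with hlt | heq
  · nlinarith [mul_pos hlt hr, mul_nonneg hy' hs.le]
  · have : y' = 1 := by linarith
    subst this
    nlinarith

lemma seg_consec (p q r : Pt) (h0 : sideSign p q r ≠ 0) :
    segment ℝ p q ∩ segment ℝ q r = {q} := by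
  ext z
  simp only [Set.mem_inter_iff, Set.mem_singleton_iff]
  constructor
  · rintro ⟨⟨x, y, hx, hy, hxy, rfl⟩, ⟨x', y', hx', hy', hxy', h⟩⟩
    have h1 := congrArg (sideSign p q) h
    rw [sideSign_convex _ _ _ _ _ _ hxy, sideSign_convex _ _ _ _ _ _ hxy'] at h1
    have h2 : sideSign p q p = 0 := by simp [sideSign]
    have h3 : sideSign p q q = 0 := by simp only [sideSign]; ring
    rw [h2, h3] at h1
    have h4 : y' * sideSign p q r = 0 := by linarith
    have h5 : y' = 0 := by simpa [h0] using h4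
    have h6 : x' = 1 := by linarith
    rw [← h, h5, h6]; simp
  · rintro rfl
    exact ⟨right_mem_segment _ _ _, left_mem_segment _ _ _⟩

lemma sideSign_ne (a b c : Pt) (hab : a ≠ b) (h : ¬ Collinear ℝ ({a, b, c} : Set Pt)) :
    sideSign a b c ≠ 0 := by
  intro h0
  apply h
  rw [collinear_iff_of_mem (p₀ := a) (by simp)]
  simp only [sideSign] at h0
  refine ⟨b - a, ?_⟩
  have hc : ∃ r : ℝ, c = r • (b - a) + a := by
    by_cases h1 : b.1 - a.1 = 0
    · have h2 : b.2 - a.2 ≠ 0 := by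
        intro h2
        exact hab (Prod.ext (by linarith) (by linarith))
      refine ⟨(c.2 - a.2) / (b.2 - a.2), ?_⟩
      rw [h1] at h0
      have h3 : c.1 - a.1 = 0 := by
        have : (b.2 - a.2) * (c.1 - a.1) = 0 := by linarith
        simpa [h2] using this
      ext
      · simp [h1]; linarith
      · simp; field_simp; ring
    · refine ⟨(c.1 - a.1) / (b.1 - a.1), ?_⟩
      ext
      · simp; field_simp; ring
      · simp; field_simp; linarith
  intro p hp
  simp only [Set.mem_insert_iff, Set.mem_singleton_iff] at hp
  rcases hp with rfl | rfl | rfl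
  · exact ⟨0, by simp⟩
  · exact ⟨1, by simp⟩
  · exact hc

lemma hull_side (a b w : Pt) (s : Set Pt) (hs : ∀ p ∈ s, 0 ≤ sideSign a b p)
    (hw : w ∈ convexHull ℝ s) : 0 ≤ sideSign a b w := by
  have hcv : Convex ℝ {p : Pt | 0 ≤ sideSign a b p} := by
    intro p hp q hq x y hx hy hxy
    simp only [Set.mem_ofPred_eq] at *
    rw [sideSign_convex _ _ _ _ _ _ hxy]
    positivity
  exact convexHull_min (s := s) hs hcv hw

lemma tri_mem (a b c p : Pt) (s : Set Pt) (ha : a ∈ s) (hb : b ∈ s) (hc : c ∈ s)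
    (h1 : 0 < sideSign a b p) (h2 : 0 < sideSign b c p) (h3 : 0 < sideSign c a p) :
    p ∈ convexHull ℝ s := by
  have hS : 0 < sideSign b c p + sideSign c a p + sideSign a b p := by positivity
  have hcv := convex_convexHull ℝ s
  have ha' := subset_convexHull ℝ s ha
  have hb' := subset_convexHull ℝ s hb
  have hc' := subset_convexHull ℝ s hc
  have hm := hcv.sum_mem (t := (Finset.univ : Finset (Fin 3)))
    (w := ![sideSign b c p / (sideSign b c p + sideSign c a p + sideSign a b p),
      sideSign c a p / (sideSign b c p + sideSign c a p + sideSign a b p),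
      sideSign a b p / (sideSign b c p + sideSign c a p + sideSign a b p)]) (z := ![a, b, c])
    (by intro i _; fin_cases i <;> simp <;> positivity)
    (by simp [Fin.sum_univ_three]; field_simp)
    (by intro i _; fin_cases i <;> simp [ha', hb', hc'])
  convert hm using 1
  simp only [Fin.sum_univ_three]
  ext
  · simp
    field_simp
    simp only [sideSign]
    ring
  · simp
    field_simp
    simp only [sideSign]
    ring

lemma core (φ : Pt → ℕ) (a b c d w : Pt)
    (hab : a ≠ b) (hac : a ≠ c) (had : a ≠ d) (haw : a ≠ w) (hbc : b ≠ c) (hbd : b ≠ d)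
    (hbw : b ≠ w) (hcd : c ≠ d) (hcw : c ≠ w) (hdw : d ≠ w)
    (h1 : 0 < sideSign a b c) (h2 : 0 < sideSign b c d) (h3 : 0 < sideSign c d a)
    (h4 : 0 < sideSign d a b)
    (hgp : GenPos ({a, b, c, d, w} : Set Pt))
    (hw : w ∈ convexHull ℝ ({a, b, c, d} : Set Pt))
    (c1 : φ a ≠ φ w) (c2 : φ w ≠ φ b) (c3 : φ b ≠ φ c) (c4 : φ c ≠ φ d) (c5 : φ d ≠ φ a) :
    ∃ γ : ZMod 5 → Pt, IsPlaneCycle φ 5 γ ∧ Set.range γ = ({a, b, c, d, w} : Set Pt) := by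
  have e1 : sideSign a b w ≠ 0 :=
    sideSign_ne _ _ _ hab (hgp a (by simp) b (by simp) w (by simp) hab haw hbw)
  have e2 : sideSign b c w ≠ 0 :=
    sideSign_ne _ _ _ hbc (hgp b (by simp) c (by simp) w (by simp) hbc hbw hcw)
  have e3 : sideSign c d w ≠ 0 :=
    sideSign_ne _ _ _ hcd (hgp c (by simp) d (by simp) w (by simp) hcd hcw hdw)
  have e4 : sideSign d a w ≠ 0 :=
    sideSign_ne _ _ _ had.symm (hgp d (by simp) a (by simp) w (by simp) had.symm hdw haw)
  have f1 : 0 < sideSign a b w := by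
    refine lt_of_le_of_ne (hull_side a b w _ ?_ hw) e1.symm
    simp only [Set.mem_insert_iff, Set.mem_singleton_iff]
    rintro p (rfl | rfl | rfl | rfl) <;> simp only [sideSign] at * <;> linarith
  have f2 : 0 < sideSign b c w := by
    refine lt_of_le_of_ne (hull_side b c w _ ?_ hw) e2.symm
    simp only [Set.mem_insert_iff, Set.mem_singleton_iff]
    rintro p (rfl | rfl | rfl | rfl) <;> simp only [sideSign] at * <;> linarith
  have f3 : 0 < sideSign c d w := by
    refine lt_of_le_of_ne (hull_side c d w _ ?_ hw) e3.symm
    simp only [Set.mem_insert_iff, Set.mem_singleton_iff]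
    rintro p (rfl | rfl | rfl | rfl) <;> simp only [sideSign] at * <;> linarith
  have f4 : 0 < sideSign d a w := by
    refine lt_of_le_of_ne (hull_side d a w _ ?_ hw) e4.symm
    simp only [Set.mem_insert_iff, Set.mem_singleton_iff]
    rintro p (rfl | rfl | rfl | rfl) <;> simp only [sideSign] at * <;> linarith
  have g1 : 0 < sideSign b c a := by simp only [sideSign] at *; linarith
  have g2 : 0 < sideSign c d b := by simp only [sideSign] at *; linarith
  let γ : ZMod 5 → Pt := (![a, w, b, c, d] : Fin 5 → Pt)
  have v0 : γ 0 = a := rfl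
  have v1 : γ 1 = w := rfl
  have v2 : γ 2 = b := rfl
  have v3 : γ 3 = c := rfl
  have v4 : γ 4 = d := rfl
  have all : ∀ P : ZMod 5 → Prop, P 0 → P 1 → P 2 → P 3 → P 4 → ∀ i, P i := by
    intro P p0 p1 p2 p3 p4 i
    have : i = 0 ∨ i = 1 ∨ i = 2 ∨ i = 3 ∨ i = 4 := by revert i; decide
    rcases this with rfl | rfl | rfl | rfl | rfl <;> assumption
  have s01 : (0 : ZMod 5) + 1 = 1 := by decide
  have s12 : (1 : ZMod 5) + 1 = 2 := by decide
  have s23 : (2 : ZMod 5) + 1 = 3 := by decide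
  have s34 : (3 : ZMod 5) + 1 = 4 := by decide
  have s40 : (4 : ZMod 5) + 1 = 0 := by decide
  have t0 : (0 : ZMod 5) + 2 = 2 := by decide
  have t1 : (1 : ZMod 5) + 2 = 3 := by decide
  have t2 : (2 : ZMod 5) + 2 = 4 := by decide
  have t3 : (3 : ZMod 5) + 2 = 0 := by decide
  have t4 : (4 : ZMod 5) + 2 = 1 := by decide
  have A : ∀ i, segment ℝ (γ i) (γ (i + 1)) ∩ segment ℝ (γ (i + 1)) (γ (i + 1 + 1))
      = ({γ (i + 1)} : Set Pt) := by
    apply all <;> simp only [s01, s12, s23, s34, s40, v0, v1, v2, v3, v4] <;>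
      apply seg_consec <;> rw [ne_iff_lt_or_gt] <;> simp only [sideSign] at * <;>
      first
      | (left; linarith)
      | (right; linarith)
  have B : ∀ i, segment ℝ (γ i) (γ (i + 1)) ∩ segment ℝ (γ (i + 2)) (γ (i + 2 + 1))
      = (∅ : Set Pt) := by
    apply all <;> simp only [s01, s12, s23, s34, s40, t0, t1, t2, t3, t4, v0, v1, v2, v3, v4]
    · rw [Set.inter_comm]; exact seg_disj _ _ _ _ g1 f2
    · rw [Set.inter_comm]; exact seg_disj _ _ _ _ f3 g2
    · exact seg_disj _ _ _ _ h2 g1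
    · exact seg_disj _ _ _ _ h3 f3
    · exact seg_disj _ _ _ _ f4 h4
  refine ⟨γ, ⟨by norm_num, ?_, ?_, ?_⟩, ?_⟩
  · intro i j
    revert i j
    apply all <;> apply all <;> simp only [v0, v1, v2, v3, v4] <;> intro h <;>
      first
      | rfl
      | trivial
      | exact absurd h (by assumption)
      | exact absurd h.symm (by assumption)
  · apply all <;> simp only [s01, s12, s23, s34, s40, v0, v1, v2, v3, v4] <;> assumption
  · intro i j hij
    constructor
    · rintro rfl
      exact A i
    · intro k1 k2
      have : j = i + 2 ∨ i = j + 2 := by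
        clear A B
        revert i j; decide
      rcases this with rfl | rfl
      · exact B i
      · rw [Set.inter_comm]; exact B j
  · ext p
    simp only [Set.mem_range, Set.mem_insert_iff, Set.mem_singleton_iff]
    constructor
    · rintro ⟨i, rfl⟩
      revert i
      apply all <;> simp [v0, v1, v2, v3, v4]
    · rintro (rfl | rfl | rfl | rfl | rfl)
      exacts [⟨0, rfl⟩, ⟨2, rfl⟩, ⟨3, rfl⟩, ⟨4, rfl⟩, ⟨1, rfl⟩]

set_option maxHeartbeats 4000000 in
/-- five points in general position, four of them forming a convex quadrilateral
with the fifth in its interior, colored with four colors such that `u` and `u'` share a color,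
admit a non-rainbow plane cycle of length 5 through all five points. -/
theorem stmt_1 (u u' v v' w : Pt) (φ : Pt → ℕ)
    (hd1 : u ≠ u') (hd2 : u ≠ v) (hd3 : u ≠ v') (hd4 : u ≠ w)
    (hd5 : u' ≠ v) (hd6 : u' ≠ v') (hd7 : u' ≠ w)
    (hd8 : v ≠ v') (hd9 : v ≠ w) (hd10 : v' ≠ w)
    (hgp : GenPos ({u, u', v, v', w} : Set Pt))
    (hconv : ConvexPosition ({u, u', v, v'} : Set Pt))
    (hint : w ∈ interior (convexHull ℝ ({u, u', v, v'} : Set Pt)))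
    (hc1 : φ u = φ u')
    (hc2 : φ u ≠ φ v) (hc3 : φ u ≠ φ v') (hc4 : φ u ≠ φ w)
    (hc5 : φ v ≠ φ v') (hc6 : φ v ≠ φ w) (hc7 : φ v' ≠ φ w) :
    ∃ γ : ZMod 5 → Pt, IsPlaneCycle φ 5 γ ∧
      Set.range γ = ({u, u', v, v', w} : Set Pt) ∧
      NonRainbow φ 5 γ := by
  have hw := interior_subset hint
  suffices H : ∃ γ : ZMod 5 → Pt, IsPlaneCycle φ 5 γ ∧
      Set.range γ = ({u, u', v, v', w} : Set Pt) by
    obtain ⟨γ, h1, h2⟩ := H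
    refine ⟨γ, h1, h2, ?_⟩
    obtain ⟨i, hi⟩ : u ∈ Set.range γ := by rw [h2]; simp
    obtain ⟨j, hj⟩ : u' ∈ Set.range γ := by rw [h2]; simp
    refine ⟨i, j, ?_, by rw [hi, hj, hc1]⟩
    rintro rfl
    exact hd1 (hi.symm.trans hj)
  have hc2' : φ u' ≠ φ v := hc1 ▸ hc2
  have hc3' : φ u' ≠ φ v' := hc1 ▸ hc3
  have hc4' : φ u' ≠ φ w := hc1 ▸ hc4
  have fin : ∀ a b c d : Pt, ({a, b, c, d} : Set Pt) = {u, u', v, v'} →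
      a ≠ b → a ≠ c → a ≠ d → a ≠ w → b ≠ c → b ≠ d → b ≠ w → c ≠ d → c ≠ w → d ≠ w →
      0 < sideSign a b c → 0 < sideSign b c d → 0 < sideSign c d a → 0 < sideSign d a b →
      φ a ≠ φ w → φ w ≠ φ b → φ b ≠ φ c → φ c ≠ φ d → φ d ≠ φ a →
      ∃ γ : ZMod 5 → Pt, IsPlaneCycle φ 5 γ ∧
        Set.range γ = ({u, u', v, v', w} : Set Pt) := by
    intro a b c d hs n1 n2 n3 n4 n5 n6 n7 n8 n9 n10 p1 p2 p3 p4 q1 q2 q3 q4 q5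
    have hs2 : ({a, b, c, d, w} : Set Pt) = {u, u', v, v', w} := by
      have e1 : ({a, b, c, d, w} : Set Pt) = {a, b, c, d} ∪ {w} := by
        ext; simp; tauto
      have e2 : ({u, u', v, v', w} : Set Pt) = {u, u', v, v'} ∪ {w} := by
        ext; simp; tauto
      rw [e1, e2, hs]
    rw [← hs2]
    exact core φ a b c d w n1 n2 n3 n4 n5 n6 n7 n8 n9 n10 p1 p2 p3 p4
      (by rw [hs2]; exact hgp) (by rw [hs]; exact hw) q1 q2 q3 q4 q5
  have tri : ∀ a b c p : Pt, a ∈ ({u, u', v, v'} : Set Pt) → b ∈ ({u, u', v, v'} : Set Pt) →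
      c ∈ ({u, u', v, v'} : Set Pt) → p ∈ ({u, u', v, v'} : Set Pt) →
      a ≠ p → b ≠ p → c ≠ p → 0 < sideSign a b p → 0 < sideSign b c p →
      0 < sideSign c a p → False := by
    intro a b c p ha hb hc hp n1 n2 n3 h1 h2 h3
    exact hconv p hp (tri_mem a b c p _ ⟨ha, n1⟩ ⟨hb, n2⟩ ⟨hc, n3⟩ h1 h2 h3)
  have k1 := sideSign_ne u u' v hd1 (hgp u (by simp) u' (by simp) v (by simp) hd1 hd2 hd5)
  have k2 := sideSign_ne u u' v' hd1 (hgp u (by simp) u' (by simp) v' (by simp) hd1 hd3 hd6)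
  have k3 := sideSign_ne u v v' hd2 (hgp u (by simp) v (by simp) v' (by simp) hd2 hd3 hd8)
  have k4 := sideSign_ne u' v v' hd5 (hgp u' (by simp) v (by simp) v' (by simp) hd5 hd6 hd8)
  have mu : u ∈ ({u, u', v, v'} : Set Pt) := by simp
  have mu' : u' ∈ ({u, u', v, v'} : Set Pt) := by simp
  have mv : v ∈ ({u, u', v, v'} : Set Pt) := by simp
  have mv' : v' ∈ ({u, u', v, v'} : Set Pt) := by simp
  rcases lt_or_gt_of_ne k1 with l1 | l1
  · rcases lt_or_gt_of_ne k2 with l2 | l2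
    · rcases lt_or_gt_of_ne k3 with l3 | l3
      · rcases lt_or_gt_of_ne k4 with l4 | l4
        · refine fin u' u v' v (by ext; simp only [Set.mem_insert_iff, Set.mem_singleton_iff]; clear * -; tauto) ?_ ?_ ?_ ?_ ?_ ?_ ?_ ?_ ?_ ?_ ?_ ?_ ?_ ?_ ?_ ?_ ?_ ?_ ?_ <;> first | assumption | exact Ne.symm (by assumption) | (simp only [sideSign] at l1 l2 l3 l4 ⊢; linarith)
        · refine (tri u' u v' v mu' mu mv' mv ?_ ?_ ?_ ?_ ?_ ?_).elim <;> first | assumption | exact Ne.symm (by assumption) | (simp only [sideSign] at l1 l2 l3 l4 ⊢; linarith)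
      · rcases lt_or_gt_of_ne k4 with l4 | l4
        · refine (tri u' u v v' mu' mu mv mv' ?_ ?_ ?_ ?_ ?_ ?_).elim <;> first | assumption | exact Ne.symm (by assumption) | (simp only [sideSign] at l1 l2 l3 l4 ⊢; linarith)
        · refine fin u' u v v' (by ext; simp only [Set.mem_insert_iff, Set.mem_singleton_iff]; clear * -; tauto) ?_ ?_ ?_ ?_ ?_ ?_ ?_ ?_ ?_ ?_ ?_ ?_ ?_ ?_ ?_ ?_ ?_ ?_ ?_ <;> first | assumption | exact Ne.symm (by assumption) | (simp only [sideSign] at l1 l2 l3 l4 ⊢; linarith)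
    · rcases lt_or_gt_of_ne k3 with l3 | l3
      · rcases lt_or_gt_of_ne k4 with l4 | l4
        · refine (tri v u' v' u mv mu' mv' mu ?_ ?_ ?_ ?_ ?_ ?_).elim <;> first | assumption | exact Ne.symm (by assumption) | (simp only [sideSign] at l1 l2 l3 l4 ⊢; linarith)
        · refine (tri v u' v' u mv mu' mv' mu ?_ ?_ ?_ ?_ ?_ ?_).elim <;> first | assumption | exact Ne.symm (by assumption) | (simp only [sideSign] at l1 l2 l3 l4 ⊢; linarith)
      · rcases lt_or_gt_of_ne k4 with l4 | l4
        · refine fin u v u' v' (by ext; simp only [Set.mem_insert_iff, Set.mem_singleton_iff]; clear * -; tauto) ?_ ?_ ?_ ?_ ?_ ?_ ?_ ?_ ?_ ?_ ?_ ?_ ?_ ?_ ?_ ?_ ?_ ?_ ?_ <;> first | assumption | exact Ne.symm (by assumption) | (simp only [sideSign] at l1 l2 l3 l4 ⊢; linarith)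
        · refine (tri u v v' u' mu mv mv' mu' ?_ ?_ ?_ ?_ ?_ ?_).elim <;> first | assumption | exact Ne.symm (by assumption) | (simp only [sideSign] at l1 l2 l3 l4 ⊢; linarith)
  · rcases lt_or_gt_of_ne k2 with l2 | l2
    · rcases lt_or_gt_of_ne k3 with l3 | l3
      · rcases lt_or_gt_of_ne k4 with l4 | l4
        · refine (tri v u v' u' mv mu mv' mu' ?_ ?_ ?_ ?_ ?_ ?_).elim <;> first | assumption | exact Ne.symm (by assumption) | (simp only [sideSign] at l1 l2 l3 l4 ⊢; linarith)
        · refine fin u v' u' v (by ext; simp only [Set.mem_insert_iff, Set.mem_singleton_iff]; clear * -; tauto) ?_ ?_ ?_ ?_ ?_ ?_ ?_ ?_ ?_ ?_ ?_ ?_ ?_ ?_ ?_ ?_ ?_ ?_ ?_ <;> first | assumption | exact Ne.symm (by assumption) | (simp only [sideSign] at l1 l2 l3 l4 ⊢; linarith)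
      · rcases lt_or_gt_of_ne k4 with l4 | l4
        · refine (tri u' v v' u mu' mv mv' mu ?_ ?_ ?_ ?_ ?_ ?_).elim <;> first | assumption | exact Ne.symm (by assumption) | (simp only [sideSign] at l1 l2 l3 l4 ⊢; linarith)
        · refine (tri u' v v' u mu' mv mv' mu ?_ ?_ ?_ ?_ ?_ ?_).elim <;> first | assumption | exact Ne.symm (by assumption) | (simp only [sideSign] at l1 l2 l3 l4 ⊢; linarith)
    · rcases lt_or_gt_of_ne k3 with l3 | l3
      · rcases lt_or_gt_of_ne k4 with l4 | l4
        · refine fin u u' v' v (by ext; simp only [Set.mem_insert_iff, Set.mem_singleton_iff]; clear * -; tauto) ?_ ?_ ?_ ?_ ?_ ?_ ?_ ?_ ?_ ?_ ?_ ?_ ?_ ?_ ?_ ?_ ?_ ?_ ?_ <;> first | assumption | exact Ne.symm (by assumption) | (simp only [sideSign] at l1 l2 l3 l4 ⊢; linarith)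
        · refine (tri u u' v v' mu mu' mv mv' ?_ ?_ ?_ ?_ ?_ ?_).elim <;> first | assumption | exact Ne.symm (by assumption) | (simp only [sideSign] at l1 l2 l3 l4 ⊢; linarith)
      · rcases lt_or_gt_of_ne k4 with l4 | l4
        · refine (tri u u' v' v mu mu' mv' mv ?_ ?_ ?_ ?_ ?_ ?_).elim <;> first | assumption | exact Ne.symm (by assumption) | (simp only [sideSign] at l1 l2 l3 l4 ⊢; linarith)
        · refine fin u u' v v' rfl ?_ ?_ ?_ ?_ ?_ ?_ ?_ ?_ ?_ ?_ ?_ ?_ ?_ ?_ ?_ ?_ ?_ ?_ ?_ <;> first | assumption | exact Ne.symm (by assumption) | (simp only [sideSign] at l1 l2 l3 l4 ⊢; linarith)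
end
end

section
/- A geometric complete multipartite graph H contains a non-rainbow plane cycle if and only if its point set P (with coloring φ) contains at least one of the configurations C1, C2, C3, C4. -/
noncomputable section

/-- Configuration C1: two pairs of equally-colored points (two distinct colors), one pair
separated by the line through the other pair. -/
def ConfigC1 (P : Set Pt) (φ : Pt → ℕ) : Prop :=
  ∃ u u' v v' : Pt, u ∈ P ∧ u' ∈ P ∧ v ∈ P ∧ v' ∈ P ∧
    u ≠ u' ∧ u ≠ v ∧ u ≠ v' ∧ u' ≠ v ∧ u' ≠ v' ∧ v ≠ v' ∧
    φ u = φ u' ∧ φ v = φ v' ∧ φ u ≠ φ v ∧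
    StrictlyOppositeSides u u' v v'

/-- Configuration C2: a monochromatic pair `u, u'` whose line separates two points of two
further, pairwise distinct, colors. -/
def ConfigC2 (P : Set Pt) (φ : Pt → ℕ) : Prop :=
  ∃ u u' v v' : Pt, u ∈ P ∧ u' ∈ P ∧ v ∈ P ∧ v' ∈ P ∧
    u ≠ u' ∧ u ≠ v ∧ u ≠ v' ∧ u' ≠ v ∧ u' ≠ v' ∧ v ≠ v' ∧
    φ u = φ u' ∧ φ v ≠ φ v' ∧ φ u ≠ φ v ∧ φ u ≠ φ v' ∧
    StrictlyOppositeSides u u' v v'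

/-- Configuration C3: a monochromatic pair `v, v'` separated by the line through two points
`u, u'` of two further, pairwise distinct, colors. -/
def ConfigC3 (P : Set Pt) (φ : Pt → ℕ) : Prop :=
  ∃ u u' v v' : Pt, u ∈ P ∧ u' ∈ P ∧ v ∈ P ∧ v' ∈ P ∧
    u ≠ u' ∧ u ≠ v ∧ u ≠ v' ∧ u' ≠ v ∧ u' ≠ v' ∧ v ≠ v' ∧
    φ v = φ v' ∧ φ u ≠ φ u' ∧ φ v ≠ φ u ∧ φ v ≠ φ u' ∧
    StrictlyOppositeSides u u' v v'

/-- Configuration C4: five points with four pairwise distinct colors (`u` and `u'` sharing a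
color), where `u, u', v, v'` form a convex quadrilateral with `w` in its interior. -/
def ConfigC4 (P : Set Pt) (φ : Pt → ℕ) : Prop :=
  ∃ u u' v v' w : Pt, u ∈ P ∧ u' ∈ P ∧ v ∈ P ∧ v' ∈ P ∧ w ∈ P ∧
    u ≠ u' ∧ u ≠ v ∧ u ≠ v' ∧ u ≠ w ∧ u' ≠ v ∧ u' ≠ v' ∧ u' ≠ w ∧
    v ≠ v' ∧ v ≠ w ∧ v' ≠ w ∧
    φ u = φ u' ∧ φ u ≠ φ v ∧ φ u ≠ φ v' ∧ φ u ≠ φ w ∧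
    φ v ≠ φ v' ∧ φ v ≠ φ w ∧ φ v' ≠ φ w ∧
    ConvexPosition ({u, u', v, v'} : Set Pt) ∧
    w ∈ interior (convexHull ℝ ({u, u', v, v'} : Set Pt))

/-- `H = (P, φ)` contains a non-rainbow plane cycle. -/
def ContainsNonRainbowPlaneCycle (P : Set Pt) (φ : Pt → ℕ) : Prop :=
  ∃ t : ℕ, ∃ γ : ZMod t → Pt, IsPlaneCycle φ t γ ∧ (∀ i, γ i ∈ P) ∧ NonRainbow φ t γ


lemma ss_comb (a b x y : Pt) (s t : ℝ) (h : s + t = 1) :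
    sideSign a b (s • x + t • y) = s * sideSign a b x + t * sideSign a b y := by
  simp only [sideSign, Prod.fst_add, Prod.snd_add, Prod.smul_fst, Prod.smul_snd, smul_eq_mul]
  linear_combination ((b.1 - a.1) * a.2 - (b.2 - a.2) * a.1) * h

lemma ss_left (a b : Pt) : sideSign a b a = 0 := by simp [sideSign]
lemma ss_right (a b : Pt) : sideSign a b b = 0 := by simp only [sideSign]; ring
lemma ss_rot (a b c : Pt) : sideSign a b c = sideSign b c a := by simp only [sideSign]; ring
lemma ss_swap (a b c : Pt) : sideSign a b c = - sideSign b a c := by simp only [sideSign]; ring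
lemma ss_swap' (a b c : Pt) : sideSign a b c = - sideSign a c b := by simp only [sideSign]; ring
lemma ss_four (a b c d : Pt) :
    sideSign b c d - sideSign a c d + sideSign a b d - sideSign a b c = 0 := by
  simp only [sideSign]; ring
lemma ss_gp (r r' q x y : Pt) :
    - (sideSign r r' q * sideSign r x y) =
      sideSign r r' y * sideSign r q x - sideSign r r' x * sideSign r q y := by
  simp only [sideSign]; ring

lemma ss_collinear (a b c : Pt) (hab : a ≠ b) (h : sideSign a b c = 0) :
    Collinear ℝ ({a, b, c} : Set Pt) := by
  rw [collinear_iff_of_mem (p₀ := a) (by simp)]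
  refine ⟨b - a, ?_⟩
  have key : ∃ t : ℝ, c = t • (b - a) + a := by
    simp only [sideSign] at h
    by_cases h1 : b.1 - a.1 = 0
    · have h2 : b.2 - a.2 ≠ 0 := by
        intro h2
        exact hab (Prod.ext (by linarith) (by linarith))
      refine ⟨(c.2 - a.2) / (b.2 - a.2), Prod.ext ?_ ?_⟩
      · simp only [Prod.fst_add, Prod.smul_fst, Prod.fst_sub, smul_eq_mul]
        rw [h1] at h ⊢
        have : (b.2 - a.2) * (c.1 - a.1) = 0 := by linarith
        rcases mul_eq_zero.1 this with h3 | h3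
        · exact absurd h3 h2
        · linarith
      · simp only [Prod.snd_add, Prod.smul_snd, Prod.snd_sub, smul_eq_mul]
        field_simp
        ring
    · refine ⟨(c.1 - a.1) / (b.1 - a.1), Prod.ext ?_ ?_⟩
      · simp only [Prod.fst_add, Prod.smul_fst, Prod.fst_sub, smul_eq_mul]
        field_simp
        ring
      · simp only [Prod.snd_add, Prod.smul_snd, Prod.snd_sub, smul_eq_mul]
        field_simp
        linarith
  intro p hp
  simp only [Set.mem_insert_iff, Set.mem_singleton_iff] at hp
  rcases hp with rfl | rfl | rfl
  · exact ⟨0, by simp⟩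
  · exact ⟨1, by simp⟩
  · simpa using key

lemma ss_ne {P : Set Pt} (hgp : GenPos P) {a b c : Pt} (ha : a ∈ P) (hb : b ∈ P) (hc : c ∈ P)
    (hab : a ≠ b) (hac : a ≠ c) (hbc : b ≠ c) : sideSign a b c ≠ 0 :=
  fun h => hgp a ha b hb c hc hab hac hbc (ss_collinear a b c hab h)

lemma seg_adj (a b c : Pt) (h : sideSign a b c ≠ 0) :
    segment ℝ a b ∩ segment ℝ b c = ({b} : Set Pt) := by
  apply Set.Subset.antisymm
  · rintro p ⟨⟨s, t, hs, ht, hst, rfl⟩, ⟨s', t', hs', ht', hst', h'⟩⟩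
    have e := congrArg (sideSign a b) h'
    rw [ss_comb _ _ _ _ _ _ hst, ss_comb _ _ _ _ _ _ hst', ss_left, ss_right] at e
    have : t' = 0 := by
      have : t' * sideSign a b c = 0 := by linarith
      rcases mul_eq_zero.1 this with h1 | h1
      · exact h1
      · exact absurd h1 h
    subst this
    have : s' = 1 := by linarith
    subst this
    rw [one_smul, zero_smul, add_zero] at h'
    exact h'.symm
  · rintro p rfl
    exact ⟨right_mem_segment _ _ _, left_mem_segment _ _ _⟩

/-- A segment strictly on the positive side misses a segment in the line. -/
lemma seg_disj_pos (a b c d : Pt) (hc : 0 < sideSign a b c) (hd : 0 < sideSign a b d) :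
    segment ℝ c d ∩ segment ℝ a b = (∅ : Set Pt) := by
  rw [Set.eq_empty_iff_forall_notMem]
  rintro p ⟨⟨s, t, hs, ht, hst, rfl⟩, ⟨s', t', hs', ht', hst', h'⟩⟩
  have e := congrArg (sideSign a b) h'
  rw [ss_comb _ _ _ _ _ _ hst, ss_comb _ _ _ _ _ _ hst', ss_left, ss_right] at e
  rcases hs.eq_or_lt with h0 | h0
  · have : t = 1 := by linarith
    subst this; subst h0; linarith
  · have := mul_pos h0 hc
    have := mul_nonneg ht hd.le
    linarith

lemma seg_disj_opp (u u' v v' : Pt) (hu : u ≠ u')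
    (h : sideSign u u' v * sideSign u u' v' < 0) :
    segment ℝ u v ∩ segment ℝ u' v' = (∅ : Set Pt) := by
  rw [Set.eq_empty_iff_forall_notMem]
  rintro p ⟨⟨s, t, hs, ht, hst, rfl⟩, ⟨s', t', hs', ht', hst', h'⟩⟩
  have e := congrArg (sideSign u u') h'
  rw [ss_comb _ _ _ _ _ _ hst, ss_comb _ _ _ _ _ _ hst', ss_left, ss_right] at e
  have ht0 : t = 0 ∧ t' = 0 := by
    have e1 : t * (sideSign u u' v) ^ 2 = t' * (sideSign u u' v * sideSign u u' v') := by
      linear_combination (- sideSign u u' v) * e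
    have e2 : t' * (sideSign u u' v') ^ 2 = t * (sideSign u u' v * sideSign u u' v') := by
      linear_combination (sideSign u u' v') * e
    constructor
    · by_contra h0
      have : 0 < t := lt_of_le_of_ne ht (Ne.symm h0)
      nlinarith [mul_neg_of_pos_of_neg this h, sq_nonneg (sideSign u u' v'),
        mul_nonneg ht' (sq_nonneg (sideSign u u' v'))]
    · by_contra h0
      have : 0 < t' := lt_of_le_of_ne ht' (Ne.symm h0)
      nlinarith [mul_neg_of_pos_of_neg this h, mul_nonneg ht (sq_nonneg (sideSign u u' v))]
  obtain ⟨rfl, rfl⟩ := ht0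
  have h1 : s = 1 := by linarith
  have h2 : s' = 1 := by linarith
  subst h1; subst h2
  simp at h'
  exact hu h'.symm

lemma seg_cross (a b c d : Pt) (h1 : sideSign a b c * sideSign a b d < 0)
    (h2 : sideSign c d a * sideSign c d b < 0) :
    (segment ℝ a b ∩ segment ℝ c d).Nonempty := by
  have hA : sideSign c d a - sideSign c d b ≠ 0 := by
    intro h; have : sideSign c d a = sideSign c d b := by linarith
    rw [this] at h2; nlinarith [sq_nonneg (sideSign c d b)]
  have hB : sideSign a b c - sideSign a b d ≠ 0 := by
    intro h; have : sideSign a b c = sideSign a b d := by linarith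
    rw [this] at h1; nlinarith [sq_nonneg (sideSign a b d)]
  have frac : ∀ m n : ℝ, m * n < 0 → 0 ≤ m / (m - n) := by
    intro m n h
    rcases mul_neg_iff.1 h with ⟨p, q⟩ | ⟨p, q⟩
    · exact div_nonneg p.le (by linarith)
    · exact div_nonneg_of_nonpos p.le (by linarith)
  have frac' : ∀ m n : ℝ, m * n < 0 → 0 ≤ - n / (m - n) := by
    intro m n h
    rcases mul_neg_iff.1 h with ⟨p, q⟩ | ⟨p, q⟩
    · exact div_nonneg (by linarith) (by linarith)
    · exact div_nonneg_of_nonpos (by linarith) (by linarith)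
  refine ⟨(- sideSign c d b / (sideSign c d a - sideSign c d b)) • a +
    (sideSign c d a / (sideSign c d a - sideSign c d b)) • b, ?_, ?_⟩
  · exact ⟨_, _, frac' _ _ h2, frac _ _ h2, by field_simp; ring, rfl⟩
  · refine ⟨_, _, frac' _ _ h1, frac _ _ h1, by field_simp; ring, ?_⟩
    have e : sideSign a b c - sideSign a b d = - (sideSign c d a - sideSign c d b) := by
      simp only [sideSign]; ring
    rw [e]
    rw [div_neg, div_neg]
    apply Prod.ext
    · simp only [Prod.fst_add, Prod.smul_fst, smul_eq_mul]
      field_simp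
      simp only [sideSign]; ring
    · simp only [Prod.snd_add, Prod.smul_snd, smul_eq_mul]
      field_simp
      simp only [sideSign]; ring

lemma hull_nonneg (a b : Pt) (s : Set Pt) (h : ∀ p ∈ s, 0 ≤ sideSign a b p) :
    ∀ p ∈ convexHull ℝ s, 0 ≤ sideSign a b p := by
  have hc : Convex ℝ {p : Pt | 0 ≤ sideSign a b p} := by
    intro x hx y hy s t hs ht hst
    simp only [Set.mem_ofPred_eq] at *
    rw [ss_comb _ _ _ _ _ _ hst]
    exact add_nonneg (mul_nonneg hs hx) (mul_nonneg ht hy)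
  exact fun p hp => convexHull_min (s := s) h hc hp

lemma not_mem_hull (s : Set Pt) (p m n o : Pt) (hs : s ⊆ {m, n, o})
    (h : sideSign m n p * sideSign m n o < 0) : p ∉ convexHull ℝ s := by
  intro hp
  have hp := convexHull_mono hs hp
  rcases mul_neg_iff.1 h with ⟨h1, h2⟩ | ⟨h1, h2⟩
  · have := hull_nonneg n m {m, n, o} (by
      intro z hz
      simp only [Set.mem_insert_iff, Set.mem_singleton_iff] at hz
      rcases hz with rfl | rfl | rfl
      · rw [ss_right]
      · rw [ss_left]
      · rw [ss_swap]; linarith) p hp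
    rw [ss_swap] at this; linarith
  · have := hull_nonneg m n {m, n, o} (by
      intro z hz
      simp only [Set.mem_insert_iff, Set.mem_singleton_iff] at hz
      rcases hz with rfl | rfl | rfl
      · rw [ss_left]
      · rw [ss_right]
      · linarith) p hp
    linarith

lemma ss_cont (a b : Pt) : Continuous (fun z => sideSign a b z) := by
  unfold sideSign; fun_prop

lemma interior_tri (a b c z : Pt) (h1 : 0 < sideSign a b z * sideSign b c z)
    (h2 : 0 < sideSign b c z * sideSign c a z) :
    z ∈ interior (convexHull ℝ ({a, b, c} : Set Pt)) := by
  rw [mem_interior]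
  refine ⟨{z | 0 < sideSign a b z * sideSign b c z ∧ 0 < sideSign b c z * sideSign c a z},
    ?_, ?_, ⟨h1, h2⟩⟩
  · rintro z ⟨h1, h2⟩
    have hT : sideSign b c z / sideSign a b c + sideSign c a z / sideSign a b c
        + sideSign a b z / sideSign a b c = 1 ∧ 0 ≤ sideSign b c z / sideSign a b c ∧
        0 ≤ sideSign c a z / sideSign a b c ∧ 0 ≤ sideSign a b z / sideSign a b c ∧
        sideSign a b c ≠ 0 := by
      have e : sideSign a b c = sideSign b c z + sideSign c a z + sideSign a b z := by
        simp only [sideSign]; ring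
      rcases mul_pos_iff.1 h1 with ⟨p, q⟩ | ⟨p, q⟩
      · have r := (pos_iff_pos_of_mul_pos h2).1 q
        have : 0 < sideSign a b c := by linarith
        refine ⟨?_, by positivity, by positivity, by positivity, this.ne'⟩
        rw [← add_div, ← add_div, ← e, div_self this.ne']
      · have r := (neg_iff_neg_of_mul_pos h2).1 q
        have : sideSign a b c < 0 := by linarith
        refine ⟨?_, div_nonneg_of_nonpos q.le this.le, div_nonneg_of_nonpos r.le this.le,
          div_nonneg_of_nonpos p.le this.le, this.ne⟩
        rw [← add_div, ← add_div, ← e, div_self this.ne]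
    obtain ⟨hs, ha, hb, hc, h0⟩ := hT
    have := (convex_convexHull ℝ ({a, b, c} : Set Pt)).sum_mem (t := Finset.univ)
      (w := ![sideSign b c z / sideSign a b c, sideSign c a z / sideSign a b c,
        sideSign a b z / sideSign a b c]) (z := ![a, b, c])
      (by intro i _; fin_cases i <;> simp [ha, hb, hc])
      (by simp [Fin.sum_univ_three, hs])
      (by intro i _; apply subset_convexHull; fin_cases i <;> simp)
    convert this using 1
    simp only [Fin.sum_univ_three, Matrix.cons_val_zero, Matrix.cons_val_one, Matrix.cons_val]
    apply Prod.ext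
    · simp only [Prod.fst_add, Prod.smul_fst, smul_eq_mul]
      field_simp
      simp only [sideSign]; ring
    · simp only [Prod.snd_add, Prod.smul_snd, smul_eq_mul]
      field_simp
      simp only [sideSign]; ring
  · apply IsOpen.inter
    · exact isOpen_lt continuous_const ((ss_cont a b).mul (ss_cont b c))
    · exact isOpen_lt continuous_const ((ss_cont b c).mul (ss_cont c a))

/-! Building cycles. -/

lemma zmod4 : ∀ i j : ZMod 4, i ≠ j → j ≠ i + 1 → i ≠ j + 1 → j = i + 2 := by decide
lemma zmod5 : ∀ i j : ZMod 5, i ≠ j → j ≠ i + 1 → i ≠ j + 1 → j = i + 2 ∨ i = j + 2 := by decide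

lemma quad_cycle {P : Set Pt} {φ : Pt → ℕ} (hgp : GenPos P) {u u' v v' : Pt}
    (hu : u ∈ P) (hu' : u' ∈ P) (hv : v ∈ P) (hv' : v' ∈ P)
    (n1 : u ≠ u') (n2 : u ≠ v) (n3 : u ≠ v') (n4 : u' ≠ v) (n5 : u' ≠ v') (n6 : v ≠ v')
    (c1 : φ u ≠ φ v) (c2 : φ v ≠ φ u') (c3 : φ u' ≠ φ v') (c4 : φ v' ≠ φ u)
    (hc : φ u = φ u' ∨ φ v = φ v') (h : StrictlyOppositeSides u u' v v') :
    ContainsNonRainbowPlaneCycle P φ := by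
  let γ : ZMod 4 → Pt := (![u, v, u', v'] : Fin 4 → Pt)
  have d1 := seg_disj_opp u u' v v' n1 h
  have d2 : segment ℝ v u' ∩ segment ℝ v' u = (∅ : Set Pt) := by
    rw [segment_symm ℝ v u', segment_symm ℝ v' u]
    apply seg_disj_opp u' u v v' n1.symm
    rw [ss_swap u' u, ss_swap u' u v']; unfold StrictlyOppositeSides at h; linarith
  have hadj : ∀ i : ZMod 4, segment ℝ (γ i) (γ (i + 1)) ∩
      segment ℝ (γ (i + 1)) (γ (i + 1 + 1)) = ({γ (i + 1)} : Set Pt) := by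
    intro i; apply seg_adj
    fin_cases i
    · exact ss_ne hgp hu hv hu' n2 n1 n4.symm
    · exact ss_ne hgp hv hu' hv' n4.symm n6 n5
    · exact ss_ne hgp hu' hv' hu n5 n1.symm n3.symm
    · exact ss_ne hgp hv' hu hv n3.symm n6.symm n2
  have hdis : ∀ i : ZMod 4, segment ℝ (γ i) (γ (i + 1)) ∩
      segment ℝ (γ (i + 2)) (γ (i + 2 + 1)) = (∅ : Set Pt) := by
    intro i
    fin_cases i
    · exact d1
    · exact d2
    · rw [Set.inter_comm]; exact d1
    · rw [Set.inter_comm]; exact d2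
  refine ⟨4, γ, ⟨by norm_num, ?_, ?_, ?_⟩, ?_, ?_⟩
  · intro i j hij
    change (![u, v, u', v'] : Fin 4 → Pt) i = (![u, v, u', v'] : Fin 4 → Pt) j at hij
    fin_cases i <;> fin_cases j <;> first | rfl | (exfalso; simp [n1, n1.symm, n2, n2.symm, n3, n3.symm, n4, n4.symm, n5, n5.symm, n6, n6.symm] at hij)
  · intro i; fin_cases i
    · exact c1
    · exact c2
    · exact c3
    · exact c4
  · intro i j hij
    refine ⟨?_, ?_⟩
    · rintro rfl; exact hadj i
    · intro h1 h2; rw [zmod4 i j hij h1 h2]; exact hdis i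
  · intro i; fin_cases i
    · exact hu
    · exact hv
    · exact hu'
    · exact hv'
  · rcases hc with hc | hc
    · exact ⟨0, 2, by decide, hc⟩
    · exact ⟨1, 3, by decide, hc⟩

lemma penta_cycle {P : Set Pt} {φ : Pt → ℕ} (hgp : GenPos P) {u u' v v' w : Pt}
    (hu : u ∈ P) (hu' : u' ∈ P) (hv : v ∈ P) (hv' : v' ∈ P) (hw : w ∈ P)
    (n1 : u ≠ u') (n2 : u ≠ v) (n3 : u ≠ v') (n4 : u ≠ w) (n5 : u' ≠ v) (n6 : u' ≠ v')
    (n7 : u' ≠ w) (n8 : v ≠ v') (n9 : v ≠ w) (n10 : v' ≠ w)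
    (c0 : φ u = φ u') (c1 : φ u ≠ φ v) (c2 : φ u ≠ φ v') (c3 : φ u ≠ φ w) (c4 : φ v ≠ φ v')
    (a1 : 0 < sideSign u u' v) (a2 : 0 < sideSign u u' v') (a4 : 0 < sideSign v v' u)
    (a5 : 0 < sideSign v v' u')
    (h : w ∈ convexHull ℝ ({u, u', v, v'} : Set Pt)) :
    ContainsNonRainbowPlaneCycle P φ := by
  let γ : ZMod 5 → Pt := (![u, w, u', v, v'] : Fin 5 → Pt)
  have b1 : 0 < sideSign u' v u := by rw [← ss_rot]; exact a1
  have b2 : 0 < sideSign u' v v' := by rw [ss_rot]; exact a5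
  have b3 : 0 < sideSign v' u u' := by rw [ss_rot]; exact a2
  have b4 : 0 < sideSign v' u v := by rw [← ss_rot]; exact a4
  have w1 : 0 < sideSign u' v w := by
    refine lt_of_le_of_ne (hull_nonneg _ _ _ ?_ w h) (ss_ne hgp hu' hv hw n5 n7 n9).symm
    intro p hp
    simp only [Set.mem_insert_iff, Set.mem_singleton_iff] at hp
    rcases hp with rfl | rfl | rfl | rfl
    · exact b1.le
    · rw [ss_left]
    · rw [ss_right]
    · exact b2.le
  have w2 : 0 < sideSign v v' w := by
    refine lt_of_le_of_ne (hull_nonneg _ _ _ ?_ w h) (ss_ne hgp hv hv' hw n8 n9 n10).symm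
    intro p hp
    simp only [Set.mem_insert_iff, Set.mem_singleton_iff] at hp
    rcases hp with rfl | rfl | rfl | rfl
    · exact a4.le
    · exact a5.le
    · rw [ss_left]
    · rw [ss_right]
  have w3 : 0 < sideSign v' u w := by
    refine lt_of_le_of_ne (hull_nonneg _ _ _ ?_ w h) (ss_ne hgp hv' hu hw n3.symm n10 n4).symm
    intro p hp
    simp only [Set.mem_insert_iff, Set.mem_singleton_iff] at hp
    rcases hp with rfl | rfl | rfl | rfl
    · rw [ss_right]
    · exact b3.le
    · exact b4.le
    · rw [ss_left]
  have hadj : ∀ i : ZMod 5, segment ℝ (γ i) (γ (i + 1)) ∩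
      segment ℝ (γ (i + 1)) (γ (i + 1 + 1)) = ({γ (i + 1)} : Set Pt) := by
    intro i; apply seg_adj
    fin_cases i
    · exact ss_ne hgp hu hw hu' n4 n1 n7.symm
    · exact ss_ne hgp hw hu' hv n7.symm n9.symm n5
    · exact ss_ne hgp hu' hv hv' n5 n6 n8
    · exact ss_ne hgp hv hv' hu n8 n2.symm n3.symm
    · exact ss_ne hgp hv' hu hw n3.symm n10 n4
  have hdis : ∀ i : ZMod 5, segment ℝ (γ i) (γ (i + 1)) ∩
      segment ℝ (γ (i + 2)) (γ (i + 2 + 1)) = (∅ : Set Pt) := by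
    intro i
    fin_cases i
    · exact seg_disj_pos _ _ _ _ b1 w1
    · exact seg_disj_pos _ _ _ _ w2 a5
    · exact seg_disj_pos _ _ _ _ b3 b4
    · rw [Set.inter_comm]; exact seg_disj_pos _ _ _ _ a4 w2
    · rw [Set.inter_comm]; exact seg_disj_pos _ _ _ _ w3 b3
  refine ⟨5, γ, ⟨by norm_num, ?_, ?_, ?_⟩, ?_, ?_⟩
  · intro i j hij
    change (![u, w, u', v, v'] : Fin 5 → Pt) i = (![u, w, u', v, v'] : Fin 5 → Pt) j at hij
    fin_cases i <;> fin_cases j <;> first | rfl | (exfalso; simp [n1, n1.symm, n2, n2.symm, n3, n3.symm, n4, n4.symm, n5, n5.symm, n6, n6.symm, n7, n7.symm, n8, n8.symm, n9, n9.symm, n10, n10.symm] at hij)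
  · intro i; fin_cases i
    · exact c3
    · exact fun h => c3 (c0.trans h.symm)
    · exact fun h => c1 (c0.trans h)
    · exact c4
    · exact fun h => c2 h.symm
  · intro i j hij
    refine ⟨?_, ?_⟩
    · rintro rfl; exact hadj i
    · intro h1 h2
      rcases zmod5 i j hij h1 h2 with h3 | h3
      · rw [h3]; exact hdis i
      · rw [h3, Set.inter_comm]; exact hdis j
  · intro i; fin_cases i
    · exact hu
    · exact hw
    · exact hu'
    · exact hv
    · exact hv'
  · exact ⟨0, 2, by decide, c0⟩

lemma nonsep1 {P : Set Pt} {φ : Pt → ℕ} (hgp : GenPos P) (h1 : ¬ ConfigC1 P φ)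
    (h2 : ¬ ConfigC2 P φ) {r r' q q' : Pt} (hr : r ∈ P) (hr' : r' ∈ P) (hq : q ∈ P)
    (hq' : q' ∈ P) (hrr : r ≠ r') (hqq : q ≠ q') (c : φ r = φ r') (c1 : φ r ≠ φ q)
    (c2 : φ r ≠ φ q') : 0 < sideSign r r' q * sideSign r r' q' := by
  have m1 : r ≠ q := fun h => c1 (h ▸ rfl)
  have m2 : r ≠ q' := fun h => c2 (h ▸ rfl)
  have m3 : r' ≠ q := fun h => c1 (h ▸ c)
  have m4 : r' ≠ q' := fun h => c2 (h ▸ c)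
  have z1 := ss_ne hgp hr hr' hq hrr m1 m3
  have z2 := ss_ne hgp hr hr' hq' hrr m2 m4
  by_contra hn
  have hlt : sideSign r r' q * sideSign r r' q' < 0 :=
    lt_of_le_of_ne (not_lt.1 hn) (mul_ne_zero z1 z2)
  by_cases hc : φ q = φ q'
  · exact h1 ⟨r, r', q, q', hr, hr', hq, hq', hrr, m1, m2, m3, m4, hqq, c, hc, c1, hlt⟩
  · exact h2 ⟨r, r', q, q', hr, hr', hq, hq', hrr, m1, m2, m3, m4, hqq, c, hc, c1, c2, hlt⟩

lemma nonsep2 {P : Set Pt} {φ : Pt → ℕ} (hgp : GenPos P) (h1 : ¬ ConfigC1 P φ)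
    (h3 : ¬ ConfigC3 P φ) {r r' q q' : Pt} (hr : r ∈ P) (hr' : r' ∈ P) (hq : q ∈ P)
    (hq' : q' ∈ P) (hrr : r ≠ r') (hqq : q ≠ q') (c : φ r = φ r') (c1 : φ r ≠ φ q)
    (c2 : φ r ≠ φ q') : 0 < sideSign q q' r * sideSign q q' r' := by
  have m1 : q ≠ r := fun h => c1 (h ▸ rfl)
  have m2 : q' ≠ r := fun h => c2 (h ▸ rfl)
  have m3 : q ≠ r' := fun h => c1 (h ▸ c)
  have m4 : q' ≠ r' := fun h => c2 (h ▸ c)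
  have z1 := ss_ne hgp hq hq' hr hqq m1 m2
  have z2 := ss_ne hgp hq hq' hr' hqq m3 m4
  by_contra hn
  have hlt : sideSign q q' r * sideSign q q' r' < 0 :=
    lt_of_le_of_ne (not_lt.1 hn) (mul_ne_zero z1 z2)
  by_cases hc : φ q = φ q'
  · exact h1 ⟨q, q', r, r', hq, hq', hr, hr', hqq, m1, m3, m2, m4, hrr, hc, c, c1.symm, hlt⟩
  · exact h3 ⟨q, q', r, r', hq, hq', hr, hr', hqq, m1, m3, m2, m4, hrr, c, hc, c1, c2, hlt⟩

/-- Pure sign computation for five points. -/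
lemma five (A B C D E F D' E' F' G : ℝ) (hAB : 0 < A * B) (hAC : 0 < A * C) (hD : 0 < D * D')
    (hE : 0 < E * E') (hF : 0 < F * F') (hDE : D * E < 0) (hAE : A * E < 0) (hG : 0 < F * G)
    (gp : -(A * F) = C * D - B * E) :
    (0 < A ∧ 0 < B ∧ 0 < C ∧ 0 < D ∧ 0 < D' ∧ E < 0 ∧ E' < 0 ∧ F < 0 ∧ F' < 0 ∧ G < 0) ∨
    (A < 0 ∧ B < 0 ∧ C < 0 ∧ D < 0 ∧ D' < 0 ∧ 0 < E ∧ 0 < E' ∧ 0 < F ∧ 0 < F' ∧ 0 < G) := by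
  rcases mul_neg_iff.1 hAE with ⟨a, e⟩ | ⟨a, e⟩
  · left
    have b := (pos_iff_pos_of_mul_pos hAB).1 a
    have c := (pos_iff_pos_of_mul_pos hAC).1 a
    have d : 0 < D := by
      by_contra hn; nlinarith [mul_nonneg_of_nonpos_of_nonpos (not_lt.1 hn) e.le]
    have f : F < 0 := by
      by_contra hn
      nlinarith [mul_nonneg a.le (not_lt.1 hn), mul_pos c d, mul_neg_of_pos_of_neg b e]
    exact ⟨a, b, c, d, (pos_iff_pos_of_mul_pos hD).1 d, e, (neg_iff_neg_of_mul_pos hE).1 e, f,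
      (neg_iff_neg_of_mul_pos hF).1 f, (neg_iff_neg_of_mul_pos hG).1 f⟩
  · right
    have b := (neg_iff_neg_of_mul_pos hAB).1 a
    have c := (neg_iff_neg_of_mul_pos hAC).1 a
    have d : D < 0 := by
      by_contra hn; nlinarith [mul_nonneg (not_lt.1 hn) e.le]
    have f : 0 < F := by
      by_contra hn
      nlinarith [mul_nonneg_of_nonpos_of_nonpos a.le (not_lt.1 hn), mul_pos_of_neg_of_neg c d,
        mul_neg_of_neg_of_pos b e]
    exact ⟨a, b, c, d, (neg_iff_neg_of_mul_pos hD).1 d, e, (pos_iff_pos_of_mul_pos hE).1 e, f,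
      (pos_iff_pos_of_mul_pos hF).1 f, (pos_iff_pos_of_mul_pos hG).1 f⟩

lemma keyQ {P : Set Pt} {φ : Pt → ℕ} (hgp : GenPos P) (h1 : ¬ ConfigC1 P φ)
    (h2 : ¬ ConfigC2 P φ) (h3 : ¬ ConfigC3 P φ) (h4 : ¬ ConfigC4 P φ) {r r' q x y : Pt}
    (hr : r ∈ P) (hr' : r' ∈ P) (hq : q ∈ P) (hx : x ∈ P) (hy : y ∈ P)
    (hrr : r ≠ r') (hqx : q ≠ x) (hqy : q ≠ y) (c : φ r = φ r') (cq : φ r ≠ φ q)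
    (cx : φ r ≠ φ x) (cy : φ r ≠ φ y) (cxy : φ x ≠ φ y)
    (hlt : sideSign r q x * sideSign r q y < 0) (hside : 0 < sideSign r q r' * sideSign r q y)
    (hG : 0 < sideSign x y r * sideSign x y q) : False := by
  have hxy : x ≠ y := fun h => cxy (h ▸ rfl)
  have e1 := nonsep1 hgp h1 h2 hr hr' hq hx hrr hqx c cq cx
  have e2 := nonsep1 hgp h1 h2 hr hr' hq hy hrr hqy c cq cy
  have e3 := nonsep2 hgp h1 h3 hr hr' hq hx hrr hqx c cq cx
  have e4 := nonsep2 hgp h1 h3 hr hr' hq hy hrr hqy c cq cy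
  have e5 := nonsep2 hgp h1 h3 hr hr' hx hy hrr hxy c cx cy
  rw [← ss_rot r, ← ss_rot r'] at e3 e4 e5
  rw [← ss_rot r, ← ss_rot q] at hG
  rw [ss_swap' r q r'] at hside
  have F := five _ _ _ _ _ _ _ _ _ _ e1 e2 e3 e4 e5 hlt (by linarith) hG (ss_gp r r' q x y)
  have t1 : sideSign r y r' = - sideSign r r' y := ss_swap' _ _ _
  have t2 : sideSign r y x = - sideSign r x y := ss_swap' _ _ _
  have t3 : sideSign r' x r = sideSign r r' x := (ss_rot _ _ _).symm
  have t4 : sideSign q x r' = sideSign r' q x := (ss_rot _ _ _).symm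
  have t5 : sideSign q y r = sideSign r q y := (ss_rot _ _ _).symm
  have t6 : sideSign q y x = - sideSign q x y := ss_swap' _ _ _
  have t7 : sideSign r y q = - sideSign r q y := ss_swap' _ _ _
  have t8 : sideSign y x q = - sideSign q x y := by rw [← ss_rot q, t6]
  have t9 : sideSign x r q = sideSign r q x := ss_rot _ _ _
  have nrx : r ≠ x := fun h => cx (h ▸ rfl)
  have nry : r ≠ y := fun h => cy (h ▸ rfl)
  have nrq : r ≠ q := fun h => cq (h ▸ rfl)
  have nrx' : r' ≠ x := fun h => cx (h ▸ c)
  have nry' : r' ≠ y := fun h => cy (h ▸ c)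
  have nrq' : r' ≠ q := fun h => cq (h ▸ c)
  by_cases k1 : φ q = φ x
  · have := nonsep1 hgp h1 h2 hq hx hr' hy hqx nry' k1 (fun h => cq (c.trans h.symm))
      (fun h => cxy (k1.symm.trans h))
    rw [t4] at this
    rcases F with F | F
    · linarith [mul_neg_of_pos_of_neg F.2.2.2.2.1 F.2.2.2.2.2.2.2.2.2]
    · linarith [mul_neg_of_neg_of_pos F.2.2.2.2.1 F.2.2.2.2.2.2.2.2.2]
  by_cases k2 : φ q = φ y
  · have := nonsep1 hgp h1 h2 hq hy hr hx hqy nrx k2 (fun h => cq h.symm)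
      (fun h => k1 h)
    rw [t5, t6] at this
    rcases F with F | F
    · linarith [mul_pos_of_neg_of_neg F.2.2.2.2.2.1 F.2.2.2.2.2.2.2.2.2]
    · linarith [mul_pos F.2.2.2.2.2.1 F.2.2.2.2.2.2.2.2.2]
  have d1 : sideSign r y r' * sideSign r y x < 0 := by
    rw [t1, t2]
    rcases F with ⟨_, _, F1, _, _, _, _, F2, _⟩ | ⟨_, _, F1, _, _, _, _, F2, _⟩
    · linarith [mul_neg_of_pos_of_neg F1 F2]
    · linarith [mul_neg_of_neg_of_pos F1 F2]
  have d2 : sideSign r' x r * sideSign r' x y < 0 := by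
    rw [t3]
    rcases F with ⟨_, F1, _, _, _, _, _, _, F2, _⟩ | ⟨_, F1, _, _, _, _, _, _, F2, _⟩
    · linarith [mul_neg_of_pos_of_neg F1 F2]
    · linarith [mul_neg_of_neg_of_pos F1 F2]
  have i1 : 0 < sideSign r y q * sideSign y x q := by
    rw [t7, t8]
    rcases F with ⟨_, _, _, _, _, F1, _, _, _, F2⟩ | ⟨_, _, _, _, _, F1, _, _, _, F2⟩
    · linarith [mul_pos_of_neg_of_neg F1 F2]
    · linarith [mul_pos F1 F2]
  have i2 : 0 < sideSign y x q * sideSign x r q := by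
    rw [t8, t9]
    rcases F with ⟨_, _, _, F1, _, _, _, _, _, F2⟩ | ⟨_, _, _, F1, _, _, _, _, _, F2⟩
    · linarith [mul_neg_of_pos_of_neg F1 F2]
    · linarith [mul_neg_of_neg_of_pos F1 F2]
  apply h4
  refine ⟨r, r', y, x, q, hr, hr', hy, hx, hq, hrr, nry, nrx, nrq, nry', nrx', nrq', hxy.symm,
    hqy.symm, hqx.symm, c, cy, cx, cq, cxy.symm, fun h => k2 h.symm, fun h => k1 h.symm, ?_, ?_⟩
  · intro p hp
    simp only [Set.mem_insert_iff, Set.mem_singleton_iff] at hp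
    rcases hp with rfl | rfl | rfl | rfl
    · exact not_mem_hull _ _ r' x y (by clear * -; intro z; simp; tauto) d2
    · exact not_mem_hull _ _ r y x (by clear * -; intro z; simp; tauto) d1
    · exact not_mem_hull _ _ r' x r (by clear * -; intro z; simp; tauto) (by linarith)
    · exact not_mem_hull _ _ r y r' (by clear * -; intro z; simp; tauto) (by linarith)
  · refine interior_mono (convexHull_mono ?_) (interior_tri r y x q i1 i2)
    clear * -
    intro z; simp; tauto

lemma keyR {P : Set Pt} {φ : Pt → ℕ} (hgp : GenPos P) (h1 : ¬ ConfigC1 P φ)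
    (h2 : ¬ ConfigC2 P φ) (h3 : ¬ ConfigC3 P φ) {r q x y : Pt}
    (hr : r ∈ P) (hq : q ∈ P) (hx : x ∈ P) (hy : y ∈ P)
    (hrx : r ≠ x) (hqy : q ≠ y) (c : φ r = φ x) (cq : φ r ≠ φ q) (cy : φ r ≠ φ y)
    (hlt : sideSign r q x * sideSign r q y < 0)
    (hG : 0 < sideSign x y r * sideSign x y q) : False := by
  have e1 := nonsep1 hgp h1 h2 hr hx hq hy hrx hqy c cq cy
  have e2 := nonsep2 hgp h1 h3 hr hx hq hy hrx hqy c cq cy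
  rw [ss_swap' r x q] at e1
  rw [← ss_rot r q y, ss_swap' q y x] at e2
  rw [← ss_rot r x y, ← ss_rot q x y] at hG
  rcases mul_neg_iff.1 hlt with ⟨a, b⟩ | ⟨a, b⟩
  · have f : sideSign r x y < 0 := by by_contra hn; nlinarith
    have g : 0 < sideSign q x y := by by_contra hn; nlinarith
    nlinarith
  · have f : 0 < sideSign r x y := by by_contra hn; nlinarith
    have g : sideSign q x y < 0 := by by_contra hn; nlinarith
    nlinarith

lemma key {P : Set Pt} {φ : Pt → ℕ} (hgp : GenPos P) (h1 : ¬ ConfigC1 P φ)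
    (h2 : ¬ ConfigC2 P φ) (h3 : ¬ ConfigC3 P φ) (h4 : ¬ ConfigC4 P φ) {r r' q x y : Pt}
    (hr : r ∈ P) (hr' : r' ∈ P) (hq : q ∈ P) (hx : x ∈ P) (hy : y ∈ P)
    (hrr : r ≠ r') (hrx : r ≠ x) (hry : r ≠ y) (hqx : q ≠ x) (hqy : q ≠ y)
    (c : φ r = φ r') (cq : φ r ≠ φ q) (cxy : φ x ≠ φ y)
    (hdis : segment ℝ r q ∩ segment ℝ x y = (∅ : Set Pt)) :
    0 < sideSign r q x * sideSign r q y := by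
  have hxy : x ≠ y := fun h => cxy (h ▸ rfl)
  have nrq : r ≠ q := fun h => cq (h ▸ rfl)
  have zy := ss_ne hgp hr hq hy nrq hry hqy
  by_contra hn
  have hlt : sideSign r q x * sideSign r q y < 0 :=
    lt_of_le_of_ne (not_lt.1 hn)
      (mul_ne_zero (ss_ne hgp hr hq hx nrq hrx hqx) zy)
  have hG : 0 < sideSign x y r * sideSign x y q := by
    by_contra hn
    have := seg_cross r q x y hlt (lt_of_le_of_ne (not_lt.1 hn)
      (mul_ne_zero (ss_ne hgp hx hy hr hxy hrx.symm hry.symm)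
        (ss_ne hgp hx hy hq hxy hqx.symm hqy.symm)))
    rw [hdis] at this
    exact Set.not_nonempty_empty this
  have hG' : 0 < sideSign y x r * sideSign y x q := by
    rw [ss_swap y x, ss_swap y x]; linarith
  have hlt' : sideSign r q y * sideSign r q x < 0 := by linarith
  by_cases kx : φ r = φ x
  · exact keyR hgp h1 h2 h3 hr hq hx hy hrx hqy kx cq (fun h => cxy (kx.symm.trans h)) hlt hG
  by_cases ky : φ r = φ y
  · exact keyR hgp h1 h2 h3 hr hq hy hx hry hqx ky cq kx hlt' hG'
  have nrq' : q ≠ r' := fun h => cq (h ▸ c)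
  have zr := ss_ne hgp hr hq hr' nrq hrr nrq'
  rcases lt_or_gt_of_ne (mul_ne_zero zr zy) with h | h
  · refine keyQ hgp h1 h2 h3 h4 hr hr' hq hy hx hrr hqy hqx c cq ky kx cxy.symm hlt' ?_ hG'
    rcases mul_neg_iff.1 h with ⟨a, b⟩ | ⟨a, b⟩
    · have f : 0 < sideSign r q x := by by_contra hn; nlinarith
      exact mul_pos a f
    · have f : sideSign r q x < 0 := by by_contra hn; nlinarith
      exact mul_pos_of_neg_of_neg a f
  · exact keyQ hgp h1 h2 h3 h4 hr hr' hq hx hy hrr hqx hqy c cq kx ky cxy hlt h hG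

lemma zcast_ne (t n : ℕ) (h0 : 0 < n) (h1 : n < t) : (n : ZMod t) ≠ 0 := by
  intro h
  rw [ZMod.natCast_eq_zero_iff] at h
  exact absurd (Nat.le_of_dvd h0 h) (by omega)

/-- All vertices off the edge `e` are on the same side of the line through the edge. -/
lemma same_side {t : ℕ} (ht : 3 ≤ t) (γ : ZMod t → Pt) (e : ZMod t)
    (hstep : ∀ j, j ≠ e → j ≠ e + 1 → j + 1 ≠ e →
      0 < sideSign (γ e) (γ (e + 1)) (γ j) * sideSign (γ e) (γ (e + 1)) (γ (j + 1)))
    (hnz : ∀ j, j ≠ e → j ≠ e + 1 → sideSign (γ e) (γ (e + 1)) (γ j) ≠ 0)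
    (j k : ZMod t) (hj : j ≠ e) (hj' : j ≠ e + 1) (hk : k ≠ e) (hk' : k ≠ e + 1) :
    0 < sideSign (γ e) (γ (e + 1)) (γ j) * sideSign (γ e) (γ (e + 1)) (γ k) := by
  have : NeZero t := ⟨by omega⟩
  have claim : ∀ n : ℕ, n + 2 < t → 0 < sideSign (γ e) (γ (e + 1)) (γ (e + (2 : ℕ))) *
      sideSign (γ e) (γ (e + 1)) (γ (e + ((n + 2 : ℕ) : ZMod t))) := by
    intro n
    have nz : ∀ m : ℕ, m + 2 < t → e + ((m + 2 : ℕ) : ZMod t) ≠ e ∧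
        e + ((m + 2 : ℕ) : ZMod t) ≠ e + 1 := by
      intro m hm
      refine ⟨fun h => zcast_ne t (m + 2) (by omega) hm (by simpa using h), fun h => ?_⟩
      apply zcast_ne t (m + 1) (by omega) (by omega)
      push_cast at h ⊢
      linear_combination h
    induction n with
    | zero =>
      intro hn
      have := nz 0 hn
      exact mul_self_pos.2 (hnz _ this.1 this.2)
    | succ n ih =>
      intro hn
      have a := ih (by omega)
      have b := nz n (by omega)
      have b' := nz (n + 1) hn
      have e1 : e + ((n + 2 : ℕ) : ZMod t) + 1 = e + ((n + 1 + 2 : ℕ) : ZMod t) := by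
        push_cast; ring
      have s := hstep _ b.1 b.2 (by rw [e1]; exact b'.1)
      rw [e1] at s
      have h3 := mul_pos a s
      have h4 := mul_self_pos.2 (hnz _ b.1 b.2)
      by_contra hn
      nlinarith [mul_nonneg (neg_nonneg.2 (not_lt.1 hn)) h4.le]
  have rep : ∀ j : ZMod t, j ≠ e → j ≠ e + 1 →
      ∃ n : ℕ, n + 2 < t ∧ j = e + ((n + 2 : ℕ) : ZMod t) := by
    intro j h h'
    have hv : ((j - e).val : ZMod t) = j - e := ZMod.natCast_zmod_val _
    have hlt := ZMod.val_lt (j - e)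
    have n0 : (j - e).val ≠ 0 := by
      intro h0; rw [h0] at hv; apply h; push_cast at hv; linear_combination -hv
    have n1 : (j - e).val ≠ 1 := by
      intro h0; rw [h0] at hv; apply h'; push_cast at hv; linear_combination -hv
    refine ⟨(j - e).val - 2, by omega, ?_⟩
    rw [show (j - e).val - 2 + 2 = (j - e).val by omega, hv]; ring
  obtain ⟨n, hn, en⟩ := rep j hj hj'
  obtain ⟨m, hm, em⟩ := rep k hk hk'
  have a := claim n hn
  have b := claim m hm
  rw [← en] at a
  rw [← em] at b
  by_contra hn
  nlinarith [mul_pos a b, mul_nonneg (neg_nonneg.2 (not_lt.1 hn))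
    (mul_self_nonneg (sideSign (γ e) (γ (e + 1)) (γ (e + (2 : ℕ)))))]

lemma forward {P : Set Pt} {φ : Pt → ℕ} (hgp : GenPos P) (h1 : ¬ ConfigC1 P φ)
    (h2 : ¬ ConfigC2 P φ) (h3 : ¬ ConfigC3 P φ) (h4 : ¬ ConfigC4 P φ) :
    ¬ ContainsNonRainbowPlaneCycle P φ := by
  rintro ⟨t, γ, ⟨ht, hinj, hcol, hseg⟩, hP, i, j, hij, hc⟩
  have t1 : (1 : ZMod t) ≠ 0 := by simpa using zcast_ne t 1 (by omega) (by omega)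
  have t2 : (2 : ZMod t) ≠ 0 := by simpa using zcast_ne t 2 (by omega) (by omega)
  have hnz : ∀ e k : ZMod t, k ≠ e → k ≠ e + 1 → sideSign (γ e) (γ (e + 1)) (γ k) ≠ 0 := by
    intro e k a b
    refine ss_ne hgp (hP _) (hP _) (hP _) (fun h => ?_) (fun h => a (hinj h).symm)
      (fun h => b (hinj h).symm)
    apply t1
    linear_combination -(hinj h)
  -- edge leaving `i`
  have A := same_side ht γ i (by
    intro k a b d
    refine key hgp h1 h2 h3 h4 (hP i) (hP j) (hP _) (hP _) (hP _)
      (fun h => hij (hinj h)) (fun h => a (hinj h).symm) (fun h => d (hinj h).symm)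
      (fun h => b (hinj h).symm) (fun h => a (add_right_cancel (hinj h)).symm) hc (hcol i) (hcol k)
      ((hseg i k a.symm).2 b d.symm)) (hnz i)
  have ei : i - 1 + 1 = i := by ring
  have B := same_side ht γ (i - 1) (by
    rw [ei]
    intro k a b d
    have := key hgp h1 h2 h3 h4 (hP i) (hP j) (hP (i - 1)) (hP k) (hP (k + 1))
      (fun h => hij (hinj h)) (fun h => b (hinj h).symm)
      (fun h => a (by linear_combination -(hinj h)))
      (fun h => a (hinj h).symm) (fun h => d (hinj h).symm) hc
      (by have := hcol (i - 1); rw [ei] at this; exact this.symm) (hcol k) (by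
        have := (hseg (i - 1) k a.symm).2 (by rw [ei]; exact b) d.symm
        rw [ei] at this
        rw [segment_symm ℝ (γ i)]; exact this)
    rw [ss_swap (γ (i - 1)), ss_swap (γ (i - 1)) (γ i) (γ (k + 1))]; linarith) (hnz (i - 1))
  rw [ei] at B
  have c1 : φ (γ i) ≠ φ (γ (i + 1)) := hcol i
  have c2 : φ (γ i) ≠ φ (γ (i - 1)) := by
    have := hcol (i - 1); rw [ei] at this; exact this.symm
  have m1 : j ≠ i + 1 := by rintro rfl; exact c1 hc
  have m2 : j ≠ i - 1 := by rintro rfl; exact c2 hc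
  have m3 : i - 1 ≠ i := fun h => t1 (by linear_combination -h)
  have m4 : i - 1 ≠ i + 1 := fun h => t2 (by linear_combination -h)
  have m5 : i + 1 ≠ i := fun h => t1 (by linear_combination h)
  have A' := A (i - 1) j m3 m4 hij.symm m1
  have B' := B (i + 1) j m4.symm m5 m2 hij.symm
  have N := nonsep1 hgp h1 h2 (hP i) (hP j) (hP (i + 1)) (hP (i - 1)) (fun h => hij (hinj h))
    (fun h => m4 (hinj h).symm) hc c1 c2
  rw [ss_swap' (γ i) (γ (i + 1)) (γ j)] at A'
  rw [ss_swap (γ (i - 1)) (γ i) (γ (i + 1)), ss_swap (γ (i - 1)) (γ i) (γ j),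
    ss_swap' (γ i) (γ (i - 1)) (γ (i + 1)), ss_swap' (γ i) (γ (i - 1)) (γ j)] at B'
  generalize sideSign (γ i) (γ (i + 1)) (γ (i - 1)) = X at *
  generalize sideSign (γ i) (γ j) (γ (i + 1)) = Y at *
  generalize sideSign (γ i) (γ j) (γ (i - 1)) = Z at *
  clear A B
  nlinarith [mul_pos A' B', mul_nonneg (mul_self_nonneg X) N.le]

lemma backward4 {P : Set Pt} {φ : Pt → ℕ} (hgp : GenPos P) (h1 : ¬ ConfigC1 P φ)
    (h2 : ¬ ConfigC2 P φ) (h3 : ¬ ConfigC3 P φ) (h4 : ConfigC4 P φ) :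
    ContainsNonRainbowPlaneCycle P φ := by
  obtain ⟨u, u', v, v', w, hu, hu', hv, hv', hw, n1, n2, n3, n4, n5, n6, n7, n8, n9, n10,
    c0, c1, c2, c3, c4, c5, c6, -, hint⟩ := h4
  have hh := interior_subset hint
  have e1 := nonsep1 hgp h1 h2 hu hu' hv hv' n1 n8 c0 c1 c2
  have e2 := nonsep2 hgp h1 h3 hu hu' hv hv' n1 n8 c0 c1 c2
  have s1 : ({u', u, v, v'} : Set Pt) = {u, u', v, v'} := Set.insert_comm _ _ _
  have s2 : ∀ a b : Pt, ({a, b, v', v} : Set Pt) = {a, b, v, v'} := by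
    intro a b; rw [Set.pair_comm]
  rcases mul_pos_iff.1 e1 with ⟨a, b⟩ | ⟨a, b⟩ <;> rcases mul_pos_iff.1 e2 with ⟨d, f⟩ | ⟨d, f⟩
  · exact penta_cycle hgp hu hu' hv hv' hw n1 n2 n3 n4 n5 n6 n7 n8 n9 n10 c0 c1 c2 c3 c4 a b d f hh
  · exact penta_cycle hgp hu hu' hv' hv hw n1 n3 n2 n4 n6 n5 n7 n8.symm n10 n9 c0 c2 c1 c3 c4.symm
      b a (by rw [ss_swap]; linarith) (by rw [ss_swap]; linarith) (by rw [s2]; exact hh)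
  · exact penta_cycle hgp hu' hu hv hv' hw n1.symm n5 n6 n7 n2 n3 n4 n8 n9 n10 c0.symm
      (c0 ▸ c1) (c0 ▸ c2) (c0 ▸ c3) c4 (by rw [ss_swap]; linarith) (by rw [ss_swap]; linarith) f d
      (by rw [s1]; exact hh)
  · exact penta_cycle hgp hu' hu hv' hv hw n1.symm n6 n5 n7 n3 n2 n4 n8.symm n10 n9 c0.symm
      (c0 ▸ c2) (c0 ▸ c1) (c0 ▸ c3) c4.symm (by rw [ss_swap]; linarith) (by rw [ss_swap]; linarith)
      (by rw [ss_swap]; linarith) (by rw [ss_swap]; linarith) (by rw [s2, s1]; exact hh)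

/-- a geometric complete multipartite graph contains a non-rainbow plane cycle
iff it contains one of the configurations C1 -- C4. -/
theorem stmt_2 (P : Set Pt) (φ : Pt → ℕ) (hfin : P.Finite) (hgp : GenPos P) :
    ContainsNonRainbowPlaneCycle P φ ↔
      ConfigC1 P φ ∨ ConfigC2 P φ ∨ ConfigC3 P φ ∨ ConfigC4 P φ := by
  constructor
  · intro h
    by_contra hn
    simp only [not_or] at hn
    exact forward hgp hn.1 hn.2.1 hn.2.2.1 hn.2.2.2 h
  · intro h
    by_cases h1 : ConfigC1 P φ
    · obtain ⟨u, u', v, v', hu, hu', hv, hv', n1, n2, n3, n4, n5, n6, c1, c2, c3, hs⟩ := h1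
      exact quad_cycle hgp hu hu' hv hv' n1 n2 n3 n4 n5 n6 c3 (fun h => c3 (c1.trans h.symm))
        (fun h => c3 (c1.trans (h.trans c2.symm))) (fun h => c3 (c2.trans h).symm) (Or.inl c1) hs
    by_cases h2 : ConfigC2 P φ
    · obtain ⟨u, u', v, v', hu, hu', hv, hv', n1, n2, n3, n4, n5, n6, c1, c2, c3, c4, hs⟩ := h2
      exact quad_cycle hgp hu hu' hv hv' n1 n2 n3 n4 n5 n6 c3 (fun h => c3 (c1.trans h.symm))
        (fun h => c4 (c1.trans h)) c4.symm (Or.inl c1) hs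
    by_cases h3 : ConfigC3 P φ
    · obtain ⟨u, u', v, v', hu, hu', hv, hv', n1, n2, n3, n4, n5, n6, c1, c2, c3, c4, hs⟩ := h3
      exact quad_cycle hgp hu hu' hv hv' n1 n2 n3 n4 n5 n6 c3.symm c4
        (fun h => c4 (c1.trans h.symm)) (fun h => c3 (c1.trans h)) (Or.inr c1) hs
    have h4 : ConfigC4 P φ := by tauto
    exact backward4 hgp h1 h2 h3 h4
end
end

section
/- A geometric complete bipartite graph H contains a plane cycle if and only if it contains a plane cycle of length 4. -/
noncomputable section

theorem aux_ss_noncol {a b c : Pt} (hab : a ≠ b) (h : ¬ Collinear ℝ ({a, b, c} : Set Pt)) :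
    sideSign a b c ≠ 0 := by
  intro h0
  apply h
  rw [collinear_iff_of_mem (p₀ := a) (by simp)]
  refine ⟨b - a, ?_⟩
  intro p hp
  simp only [Set.mem_insert_iff, Set.mem_singleton_iff] at hp
  rcases hp with rfl | rfl | rfl
  · exact ⟨0, by simp⟩
  · exact ⟨1, by simp⟩
  · unfold sideSign at h0
    by_cases hx : b.1 - a.1 = 0
    · have hy : b.2 - a.2 ≠ 0 := by
        intro hy
        exact hab (Prod.ext (by linarith) (by linarith))
      refine ⟨(p.2 - a.2) / (b.2 - a.2), ?_⟩
      have : p.1 - a.1 = 0 := by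
        rw [hx] at h0
        have : (b.2 - a.2) * (p.1 - a.1) = 0 := by linarith
        exact (mul_eq_zero.mp this).resolve_left hy
      ext
      · simp [hx]; linarith
      · simp; field_simp; ring
    · refine ⟨(p.1 - a.1) / (b.1 - a.1), ?_⟩
      ext
      · simp; field_simp; ring
      · simp; field_simp; linarith

theorem aux_adj {a b c : Pt} (h : sideSign a b c ≠ 0) :
    segment ℝ a b ∩ segment ℝ b c = ({b} : Set Pt) := by
  ext p
  simp only [Set.mem_inter_iff, Set.mem_singleton_iff]
  constructor
  · rintro ⟨⟨x, y, hx, hy, hxy, rfl⟩, ⟨z, w, hz, hw, hzw, h2⟩⟩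
    have e1 := congrArg Prod.fst h2
    have e2 := congrArg Prod.snd h2
    simp at e1 e2
    have hx' : x = 1 - y := by linarith
    have hz' : z = 1 - w := by linarith
    subst hx' hz'
    have : w * sideSign a b c = 0 := by
      unfold sideSign
      linear_combination (b.1 - a.1) * e2 - (b.2 - a.2) * e1
    have hw0 : w = 0 := (mul_eq_zero.mp this).resolve_right h
    rw [← h2, hw0]; simp
  · rintro rfl
    exact ⟨right_mem_segment _ _ _, left_mem_segment _ _ _⟩

theorem aux_disj {u u' v v' : Pt} (hu : u ≠ u')
    (h : sideSign u u' v * sideSign u u' v' < 0) :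
    segment ℝ u v ∩ segment ℝ u' v' = (∅ : Set Pt) := by
  ext p
  simp only [Set.mem_inter_iff, Set.mem_empty_iff_false, iff_false]
  rintro ⟨⟨x, y, hx, hy, hxy, rfl⟩, ⟨z, w, hz, hw, hzw, h2⟩⟩
  have e1 := congrArg Prod.fst h2
  have e2 := congrArg Prod.snd h2
  simp at e1 e2
  have hx' : x = 1 - y := by linarith
  have hz' : z = 1 - w := by linarith
  subst hx' hz'
  have key : y * sideSign u u' v = w * sideSign u u' v' := by
    unfold sideSign
    linear_combination -(u'.1 - u.1) * e2 + (u'.2 - u.2) * e1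
  have hyw : y = 0 ∧ w = 0 := by
    rcases mul_neg_iff.mp h with ⟨h1, h3⟩ | ⟨h1, h3⟩
    · have a1 := mul_nonneg hy h1.le
      have a2 := mul_nonpos_of_nonneg_of_nonpos hw h3.le
      exact ⟨(mul_eq_zero.mp (by linarith)).resolve_right h1.ne',
        (mul_eq_zero.mp (by linarith)).resolve_right h3.ne⟩
    · have a1 := mul_nonneg hw h3.le
      have a2 := mul_nonpos_of_nonneg_of_nonpos hy h1.le
      exact ⟨(mul_eq_zero.mp (by linarith)).resolve_right h1.ne,
        (mul_eq_zero.mp (by linarith)).resolve_right h3.ne'⟩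
  obtain ⟨rfl, rfl⟩ := hyw
  apply hu
  ext
  · linarith
  · linarith

theorem aux_cross {r b' q b : Pt} (hA : sideSign r b' q < 0) (hB : 0 < sideSign r b' b)
    (hC : 0 < sideSign q b r) (hD : sideSign q b b' < 0) :
    (segment ℝ b q ∩ segment ℝ b' r).Nonempty := by
  have hCD : sideSign q b r - sideSign q b b' = sideSign r b' b - sideSign r b' q := by
    unfold sideSign; ring
  have hpos : 0 < sideSign r b' b - sideSign r b' q := by linarith
  have hpos' := hpos.ne'
  refine ⟨(-(sideSign r b' q) / (sideSign r b' b - sideSign r b' q)) • b +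
    (sideSign r b' b / (sideSign r b' b - sideSign r b' q)) • q, ?_, ?_⟩
  · refine ⟨_, _, ?_, ?_, ?_, rfl⟩
    · exact div_nonneg (by linarith) hpos.le
    · exact div_nonneg (by linarith) hpos.le
    · field_simp; ring
  · refine ⟨(sideSign q b r) / (sideSign r b' b - sideSign r b' q),
      -(sideSign q b b') / (sideSign r b' b - sideSign r b' q), ?_, ?_, ?_, ?_⟩
    · exact div_nonneg (by linarith) hpos.le
    · exact div_nonneg (by linarith) hpos.le
    · field_simp; linarith
    · ext
      · simp only [Prod.fst_add, Prod.smul_fst, smul_eq_mul]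
        field_simp
        unfold sideSign; ring
      · simp only [Prod.snd_add, Prod.smul_snd, smul_eq_mul]
        field_simp
        unfold sideSign; ring

theorem aux_four (φ : Pt → ℕ) {r q b b' : Pt} (hrq : r ≠ q) (hbb : b ≠ b')
    (h1 : φ r ≠ φ b) (h2 : φ b ≠ φ q) (h3 : φ q ≠ φ b') (h4 : φ b' ≠ φ r)
    (n1 : sideSign r b q ≠ 0) (n2 : sideSign b q b' ≠ 0)
    (n3 : sideSign q b' r ≠ 0) (n4 : sideSign b' r b ≠ 0)
    (h : sideSign r q b * sideSign r q b' < 0) :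
    IsPlaneCycle φ 4 (![r, b, q, b'] : Fin 4 → Pt) := by
  have d1 : r ≠ b := fun e => h1 (by rw [e])
  have d2 : b ≠ q := fun e => h2 (by rw [e])
  have d3 : q ≠ b' := fun e => h3 (by rw [e])
  have d4 : b' ≠ r := fun e => h4 (by rw [e])
  have E1 : segment ℝ r b ∩ segment ℝ q b' = ∅ := aux_disj hrq h
  have E2 : segment ℝ b q ∩ segment ℝ b' r = ∅ := by
    rw [segment_symm ℝ b q, segment_symm ℝ b' r, Set.inter_comm]
    exact aux_disj hrq (by linarith)
  have E3 := aux_adj n1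
  have E4 := aux_adj n2
  have E5 := aux_adj n3
  have E6 := aux_adj n4
  refine ⟨by norm_num, ?_, ?_, ?_⟩
  · change Function.Injective (![r, b, q, b'] : Fin 4 → Pt)
    intro i j hij
    fin_cases i <;> fin_cases j <;> simp_all
  · change ∀ i : Fin 4, φ ((![r, b, q, b'] : Fin 4 → Pt) i) ≠ φ ((![r, b, q, b'] : Fin 4 → Pt) (i+1))
    intro i
    fin_cases i <;> assumption
  · have E1' := Set.inter_comm _ _ ▸ E1
    have E2' := Set.inter_comm _ _ ▸ E2
    have key : ∀ i j : Fin 4, i ≠ j →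
      (j = i + 1 →
      segment ℝ ((![r, b, q, b'] : Fin 4 → Pt) i) ((![r, b, q, b'] : Fin 4 → Pt) (i + 1)) ∩
       segment ℝ ((![r, b, q, b'] : Fin 4 → Pt) j) ((![r, b, q, b'] : Fin 4 → Pt) (j + 1))
         = ({(![r, b, q, b'] : Fin 4 → Pt) (i + 1)} : Set Pt)) ∧
      (j ≠ i + 1 → i ≠ j + 1 →
      segment ℝ ((![r, b, q, b'] : Fin 4 → Pt) i) ((![r, b, q, b'] : Fin 4 → Pt) (i + 1)) ∩
       segment ℝ ((![r, b, q, b'] : Fin 4 → Pt) j) ((![r, b, q, b'] : Fin 4 → Pt) (j + 1))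
         = (∅ : Set Pt)) := by
      intro i j hij
      constructor
      · rintro rfl
        fin_cases i <;> assumption
      · intro ha hb
        fin_cases i <;> fin_cases j <;>
          first
          | exact absurd rfl hij
          | exact absurd rfl ha
          | exact absurd rfl hb
          | exact E1
          | exact E2
          | exact (Set.inter_comm _ _).trans E1
          | exact (Set.inter_comm _ _).trans E2
    exact key

/-- a geometric complete bipartite graph contains a plane cycle iff it contains
a plane cycle of length 4. -/
theorem stmt_4 (P : Set Pt) (φ : Pt → ℕ) (hfin : P.Finite) (hgp : GenPos P)
    (hbip : ∃ c₁ c₂ : ℕ, c₁ ≠ c₂ ∧ φ '' P = {c₁, c₂}) :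
    (∃ t : ℕ, ∃ γ : ZMod t → Pt, IsPlaneCycle φ t γ ∧ ∀ i, γ i ∈ P) ↔
      (∃ γ : ZMod 4 → Pt, IsPlaneCycle φ 4 γ ∧ ∀ i, γ i ∈ P) := by
  constructor
  swap
  · rintro ⟨γ, h⟩
    exact ⟨4, γ, h⟩
  rintro ⟨t, γ, ⟨ht, hinj, hcol, hpl⟩, hP⟩
  by_contra hno
  obtain ⟨c₁, c₂, hc, hφ⟩ := hbip
  have two : ∀ p ∈ P, φ p = c₁ ∨ φ p = c₂ := by
    intro p hp
    have : φ p ∈ φ '' P := ⟨p, hp, rfl⟩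
    rw [hφ] at this
    simpa using this
  have same : ∀ x ∈ P, ∀ y ∈ P, ∀ z ∈ P, φ x ≠ φ y → φ y ≠ φ z → φ x = φ z := by
    intro x hx y hy z hz h1 h2
    have := two x hx
    have := two y hy
    have := two z hz
    omega
  have ne0 : ∀ a ∈ P, ∀ b ∈ P, ∀ c ∈ P, a ≠ b → a ≠ c → b ≠ c → sideSign a b c ≠ 0 :=
    fun a ha b hb c hc h1 h2 h3 => aux_ss_noncol h1 (hgp a ha b hb c hc h1 h2 h3)
  have sep : ∀ r ∈ P, ∀ q ∈ P, ∀ b ∈ P, ∀ b' ∈ P, r ≠ q → b ≠ b' → φ r = φ q → φ b = φ b' →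
      φ r ≠ φ b → 0 < sideSign r q b * sideSign r q b' := by
    intro r hr q hq b hb b' hb' hrq hbb h1 h2 h3
    have d1 : r ≠ b := fun e => h3 (by rw [e])
    have d2 : b ≠ q := fun e => h3 (by rw [e, h1])
    have d3 : q ≠ b' := fun e => h3 (by rw [h1, h2, e])
    have d4 : b' ≠ r := fun e => h3 (by rw [h2, e])
    by_contra hneg
    have hlt : sideSign r q b * sideSign r q b' < 0 := by
      refine lt_of_le_of_ne (not_lt.mp hneg) (mul_ne_zero ?_ ?_)
      · exact ne0 r hr q hq b hb hrq d1 d2.symm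
      · exact ne0 r hr q hq b' hb' hrq d4.symm d3
    apply hno
    refine ⟨_, aux_four φ hrq hbb h3 ?_ ?_ ?_ ?_ ?_ ?_ ?_ hlt, ?_⟩
    · rw [← h1]; exact h3.symm
    · rw [← h1, ← h2]; exact h3
    · rw [← h2]; exact h3.symm
    · exact ne0 r hr b hb q hq d1 hrq d2
    · exact ne0 b hb q hq b' hb' d2 hbb d3
    · exact ne0 q hq b' hb' r hr d3 hrq.symm d4
    · exact ne0 b' hb' r hr b hb d4 hbb.symm d1
    · have : ∀ i : Fin 4, (![r, b, q, b'] : Fin 4 → Pt) i ∈ P := by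
        intro i
        fin_cases i <;> assumption
      exact this
  have : NeZero t := ⟨by omega⟩
  have small : ∀ n : ℕ, 0 < n → n < t → (n : ZMod t) ≠ 0 := by
    intro n hn hnt h0
    rw [ZMod.natCast_eq_zero_iff] at h0
    exact absurd (Nat.le_of_dvd hn h0) (by omega)
  have s1 : (1 : ZMod t) ≠ 0 := by exact_mod_cast small 1 (by omega) (by omega)
  have s2 : (2 : ZMod t) ≠ 0 := by exact_mod_cast small 2 (by omega) (by omega)
  have col2 : ∀ i, φ (γ i) = φ (γ (i + 2)) := by
    intro i
    have h1 := hcol i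
    have h2 := hcol (i + 1)
    rw [show i + 1 + 1 = i + 2 by ring] at h2
    exact same _ (hP _) _ (hP _) _ (hP _) h1 h2
  have s3 : (3 : ZMod t) ≠ 0 := by
    intro h3
    have h1 := hcol 2
    have h2 := col2 0
    rw [show (2 : ZMod t) + 1 = 0 by rw [← h3]; ring] at h1
    rw [zero_add] at h2
    exact h1 h2.symm
  -- extreme red point
  have hb01 : γ 0 ≠ γ 2 := fun e => s2 (hinj e).symm
  obtain ⟨i, hi, hmax⟩ := Set.exists_max_image {i : ZMod t | φ (γ i) ≠ φ (γ 0)}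
    (fun i => (((γ 2).1 - (γ 0).1) * ((γ i).1 - (γ 0).1) +
      ((γ 2).2 - (γ 0).2) * ((γ i).2 - (γ 0).2)) / sideSign (γ 0) (γ 2) (γ i))
    (Set.toFinite _) ⟨1, by have := hcol 0; rw [zero_add] at this; exact this.symm⟩
  simp only [Set.mem_ofPred_eq] at hi hmax
  have c02 := col2 0
  rw [zero_add] at c02
  have X0 : ∀ j, φ (γ j) = φ (γ i) → j ≠ i → sideSign (γ 0) (γ j) (γ i) < 0 := by
    intro j hj hji
    have hj0 : φ (γ j) ≠ φ (γ 0) := by rw [hj]; exact hi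
    have hle := hmax j hj0
    have hp := sep _ (hP 0) _ (hP 2) _ (hP j) _ (hP i) hb01 (fun e => hji (hinj e)) c02 hj
      hj0.symm
    have hne : sideSign (γ 0) (γ j) (γ i) ≠ 0 := by
      apply ne0 _ (hP _) _ (hP _) _ (hP _)
      · intro e; exact hj0 (by rw [e])
      · intro e; exact hi (by rw [e])
      · intro e; exact hji (hinj e)
    have n1 : sideSign (γ 0) (γ 2) (γ j) ≠ 0 := left_ne_zero_of_mul hp.ne'
    have n2 : sideSign (γ 0) (γ 2) (γ i) ≠ 0 := right_ne_zero_of_mul hp.ne'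
    have hle2 := mul_le_mul_of_nonneg_right hle hp.le
    rw [show ∀ x y z : ℝ, x / y * (y * z) = x / y * y * z by intros; ring,
      div_mul_cancel₀ _ n1,
      show ∀ x y z : ℝ, x / z * (y * z) = x / z * z * y by intros; ring,
      div_mul_cancel₀ _ n2] at hle2
    have hd : 0 < ((γ 2).1 - (γ 0).1) ^ 2 + ((γ 2).2 - (γ 0).2) ^ 2 := by
      by_contra hcon
      apply hb01
      have e1 : (γ 2).1 - (γ 0).1 = 0 := by nlinarith [sq_nonneg ((γ 2).1 - (γ 0).1), sq_nonneg ((γ 2).2 - (γ 0).2)]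
      have e2 : (γ 2).2 - (γ 0).2 = 0 := by nlinarith [sq_nonneg ((γ 2).1 - (γ 0).1), sq_nonneg ((γ 2).2 - (γ 0).2)]
      exact Prod.ext (by linarith) (by linarith)
    refine lt_of_le_of_ne ?_ hne
    by_contra hpos
    have := mul_pos (not_le.mp hpos) hd
    unfold sideSign at this hle2
    linarith
  have X : ∀ k j, φ (γ k) ≠ φ (γ i) → φ (γ j) = φ (γ i) → j ≠ i →
      sideSign (γ k) (γ j) (γ i) < 0 := by
    intro k j hk hj hji
    have h0 := X0 j hj hji
    by_cases hk0 : k = 0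
    · rw [hk0]; exact h0
    have hck : φ (γ k) = φ (γ 0) := same _ (hP _) _ (hP _) _ (hP _) hk hi
    have := sep _ (hP j) _ (hP i) _ (hP k) _ (hP 0) (fun e => hji (hinj e))
      (fun e => hk0 (hinj e)) hj hck (by rw [hj]; exact hk.symm)
    have cyc : ∀ a b c : Pt, sideSign a b c = sideSign b c a := by
      intros; unfold sideSign; ring
    rw [← cyc (γ k) (γ j) (γ i), ← cyc (γ 0) (γ j) (γ i)] at this
    by_contra hcon
    have := mul_nonpos_of_nonneg_of_nonpos (not_lt.mp hcon) h0.le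
    linarith
  have fin : ∀ k k' j, φ (γ k) ≠ φ (γ i) → φ (γ k') ≠ φ (γ i) → φ (γ j) = φ (γ i) → j ≠ i →
      k ≠ k' → sideSign (γ i) (γ k) (γ k') < 0 →
      (segment ℝ (γ k) (γ j) ∩ segment ℝ (γ k') (γ i)).Nonempty := by
    intro k k' j hk hk' hj hji hkk hσ
    have x1 := X k j hk hj hji
    have x2 := X k' j hk' hj hji
    have hckk : φ (γ k) = φ (γ k') := same _ (hP _) _ (hP i) _ (hP _) hk hk'.symm
    have hs := sep _ (hP k) _ (hP k') _ (hP i) _ (hP j) (fun e => hkk (hinj e))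
      (fun e => hji (hinj e).symm) hckk hj.symm hk
    have cyc : ∀ a b c : Pt, sideSign a b c = sideSign b c a := by
      intros; unfold sideSign; ring
    have asy : ∀ a b c : Pt, sideSign a b c = - sideSign a c b := by
      intros; unfold sideSign; ring
    rw [← cyc, ← cyc (γ j)] at hs
    apply aux_cross
    · rw [cyc]; exact x2
    · rw [asy]; linarith
    · rw [cyc, asy]; linarith
    · by_contra hcon
      have := mul_nonpos_of_nonpos_of_nonneg hσ.le (not_lt.mp hcon)
      linarith
  have hc1 : φ (γ (i + 1)) ≠ φ (γ i) := (hcol i).symm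
  have hc2 : φ (γ (i - 1)) ≠ φ (γ i) := by
    have := hcol (i - 1)
    rwa [sub_add_cancel] at this
  have hc3 := (col2 i).symm
  have hc4 : φ (γ (i - 2)) = φ (γ i) := by
    have := col2 (i - 2)
    rwa [sub_add_cancel] at this
  have hd1 : i + 1 ≠ i - 1 := fun e => s2 (by linear_combination e)
  have hd2 : i + 2 ≠ i := fun e => s2 (by linear_combination e)
  have hd3 : i - 2 ≠ i := fun e => s2 (by linear_combination -e)
  have hσ : sideSign (γ i) (γ (i + 1)) (γ (i - 1)) ≠ 0 := by
    apply ne0 _ (hP _) _ (hP _) _ (hP _)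
    · intro e; exact hc1 (by rw [← e])
    · intro e; exact hc2 (by rw [← e])
    · intro e; exact hd1 (hinj e)
  rcases lt_or_gt_of_ne hσ with h | h
  · have hn := fin _ _ _ hc1 hc2 hc3 hd2 hd1 h
    have he := (hpl (i + 1) (i - 1) hd1).2 (fun e => s3 (by linear_combination -e))
      (fun e => s1 (by linear_combination e))
    rw [show i + 1 + 1 = i + 2 by ring, sub_add_cancel] at he
    rw [he] at hn
    exact Set.not_nonempty_empty hn
  · have h' : sideSign (γ i) (γ (i - 1)) (γ (i + 1)) < 0 := by
      unfold sideSign at h ⊢; linarith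
    have hn := fin _ _ _ hc2 hc1 hc4 hd3 hd1.symm h'
    have he := (hpl (i - 2) i hd3).2 (fun e => s1 (by linear_combination e))
      (fun e => s3 (by linear_combination -e))
    rw [show i - 2 + 1 = i - 1 by ring, segment_symm ℝ (γ (i - 2)), segment_symm ℝ (γ i)] at he
    rw [he] at hn
    exact Set.not_nonempty_empty hn
end
end
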